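/- Let F be a field of characteristic 2, G ⊆ SL(3, F) a finite subgroup, and V = F³ = Fv ⊕ W a direct sum of G-submodules with dim_F W = 2. Suppose T(G)|_W acts irreducibly and imprimitively on W, i.e., there is a decomposition W = L₁ ⊕ L₂ into two lines that are permuted by T(G)|_W. Then the commutator subgroup of T(G)|_W is cyclic of some order d, consisting of the diagonal matrices diag(ζ, ζ⁻¹) with ζ^d = 1, and S(V)^G is Gorenstein if and only if for every g ∈ G there exist τ ∈ T(G) and a scalar ζ ∈ F with ζ^d = 1 such that g|_W = ζ · (τ|_W); i.e., G|_W ⊆ ⟨T(G)|_W, δI_W⟩ for δ a primitive d-th root of unity. -/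

import Mathlib

noncomputable section
open CategoryTheory Matrix MvPolynomial

universe u

/-- A module `M` over `R` has finite injective dimension iff the Ext functors
`Ext^i(-, M)` vanish for all sufficiently large `i`. -/
def HasFiniteInjectiveDimension (R : Type u) [CommRing R] (M : ModuleCat.{u} R) : Prop :=
  ∃ n : ℕ, ∀ (N : ModuleCat.{u} R) (i : ℕ), n < i →
    Subsingleton (((Ext R (ModuleCat.{u} R) i).obj (Opposite.op N)).obj M)

/-- A commutative ring is Gorenstein if it is Noetherian and its localization at every
prime ideal has finite injective dimension over itself. -/
def IsGorensteinRing (R : Type u) [CommRing R] : Prop :=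
  IsNoetherianRing R ∧ ∀ (P : Ideal R) [P.IsPrime],
    HasFiniteInjectiveDimension (Localization.AtPrime P)
      (ModuleCat.of (Localization.AtPrime P) (Localization.AtPrime P))

/-- The substitution action of a matrix on polynomials: `X i ↦ ∑ j, M i j • X j`. -/
def polyAct {F : Type u} [CommSemiring F] {m : ℕ} (M : Matrix (Fin m) (Fin m) F) :
    MvPolynomial (Fin m) F →ₐ[F] MvPolynomial (Fin m) F :=
  MvPolynomial.aeval fun i => ∑ j, M i j • MvPolynomial.X j

/-- The subalgebra of polynomials invariant under a set of matrices. -/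
def invariantAlg {F : Type u} [CommSemiring F] {m : ℕ} (S : Set (Matrix (Fin m) (Fin m) F)) :
    Subalgebra F (MvPolynomial (Fin m) F) where
  carrier := {f | ∀ M ∈ S, polyAct M f = f}
  mul_mem' := fun hf hg => fun M hM => by rw [_root_.map_mul, hf M hM, hg M hM]
  add_mem' := fun hf hg => fun M hM => by rw [_root_.map_add, hf M hM, hg M hM]
  algebraMap_mem' := fun r => fun M hM => (polyAct M).commutes r

/-- The invariant ring `S(V)^G` for a subgroup `G` of `SL(m, F)`, where `S(V)` is realised
as the polynomial ring `F[X 0, …, X (m-1)]`. -/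
def invariantRing {F : Type u} [Field F] {m : ℕ}
    (G : Subgroup (Matrix.SpecialLinearGroup (Fin m) F)) :
    Subalgebra F (MvPolynomial (Fin m) F) :=
  invariantAlg {M | ∃ g ∈ G, (g : Matrix (Fin m) (Fin m) F) = M}

/-- A matrix `M` is a transvection if `rank (M - 1) = 1` and `(M - 1)² = 0`. -/
def IsTransvectionMat {F : Type u} [Field F] {m : ℕ} (M : Matrix (Fin m) (Fin m) F) : Prop :=
  (M - 1).rank = 1 ∧ (M - 1) * (M - 1) = 0

/-- `T(G)`: the subgroup generated by all transvections contained in `G`. -/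
def transSubgroup {F : Type u} [Field F] {m : ℕ}
    (G : Subgroup (Matrix.SpecialLinearGroup (Fin m) F)) :
    Subgroup (Matrix.SpecialLinearGroup (Fin m) F) :=
  Subgroup.closure {g | g ∈ G ∧ IsTransvectionMat (g : Matrix (Fin m) (Fin m) F)}

/-- The matrix of the restriction `g|W` of `g` to the coordinate plane
`W = span {e 1, e 2}` (with respect to the standard basis `{e 1, e 2}` of `W`). -/
def subW {F : Type u} [Field F] (g : Matrix.SpecialLinearGroup (Fin 3) F) :
    Matrix (Fin 2) (Fin 2) F :=
  Matrix.submatrix (g : Matrix (Fin 3) (Fin 3) F) Fin.succ Fin.succ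

section ExtComparison

open Opposite

lemma ext_subsingleton_iff {R : Type u} [CommRing R] (N M : ModuleCat.{u} R) (i : ℕ) :
    Subsingleton (((Ext R (ModuleCat.{u} R) (i + 1)).obj (op N)).obj M) ↔
      Subsingleton (Abelian.Ext N M (i + 1)) := by
  let P := projectiveResolution N
  rw [← ModuleCat.isZero_iff_subsingleton, (P.isoExt (R := R) (i + 1) M).isZero_iff,
    ← HomologicalComplex.exactAt_iff_isZero_homology,
    HomologicalComplex.exactAt_iff' _ i (i + 1) (i + 2) (by simp) (by simp),
    ShortComplex.moduleCat_exact_iff]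
  constructor
  · intro h
    refine subsingleton_of_forall_eq 0 fun α => ?_
    obtain ⟨f, hf, rfl⟩ := P.extMk_surjective α (i + 2) rfl
    rw [P.extMk_eq_zero_iff f (i + 2) rfl hf i rfl]
    obtain ⟨g, hg⟩ := h f hf
    exact ⟨g, hg⟩
  · intro h f hf
    exact (P.extMk_eq_zero_iff f (i + 2) rfl hf i rfl).1 (Subsingleton.elim _ _)

lemma hasFiniteInjectiveDimension_iff {R : Type u} [CommRing R] (M : ModuleCat.{u} R) :
    HasFiniteInjectiveDimension R M ↔ ∃ n : ℕ, HasInjectiveDimensionLE M n := by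
  refine exists_congr fun n => ?_
  rw [HasInjectiveDimensionLE, hasInjectiveDimensionLT_iff]
  constructor
  · rintro h (_ | i) hi Y e
    · omega
    · have := (ext_subsingleton_iff Y M i).1 (h Y (i + 1) (by omega))
      exact Subsingleton.elim _ _
  · rintro h N (_ | i) hi
    · omega
    · exact (ext_subsingleton_iff N M i).2 (subsingleton_of_forall_eq 0 fun e => h (i + 1) (by omega) e)

end ExtComparison

section Coinduced

/-- The `A`-module `Hom_B(A, M)` coinduced from a `B`-module `M`. -/
def Coind (B A M : Type*) [CommRing B] [CommRing A] [Algebra B A] [AddCommGroup M] [Module B M] :=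
  A →ₗ[B] M

namespace Coind

variable {B A M N : Type*} [CommRing B] [CommRing A] [Algebra B A] [AddCommGroup M] [Module B M]
  [AddCommGroup N] [Module B N]

instance : AddCommGroup (Coind B A M) := inferInstanceAs (AddCommGroup (A →ₗ[B] M))

instance : FunLike (Coind B A M) A M := inferInstanceAs (FunLike (A →ₗ[B] M) A M)

instance : LinearMapClass (Coind B A M) B A M :=
  inferInstanceAs (LinearMapClass (A →ₗ[B] M) B A M)

@[ext] lemma ext {φ ψ : Coind B A M} (h : ∀ a, φ a = ψ a) : φ = ψ := DFunLike.ext φ ψ h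

@[simp] lemma add_apply (φ ψ : Coind B A M) (a : A) : (φ + ψ) a = φ a + ψ a := rfl

@[simp] lemma zero_apply (a : A) : (0 : Coind B A M) a = 0 := rfl

instance : Module A (Coind B A M) where
  smul a φ := LinearMap.comp φ (LinearMap.mulRight B a)
  one_smul φ := by ext a; exact congrArg φ (mul_one a)
  mul_smul a b φ := by
    ext c; exact congrArg φ (show c * (a * b) = (c * a) * b by ring)
  smul_zero _ := rfl
  smul_add _ _ _ := rfl
  add_smul a b φ := by
    ext c; exact (congrArg φ (mul_add c a b)).trans (_root_.map_add φ _ _)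
  zero_smul φ := by
    ext c; exact (congrArg φ (mul_zero c)).trans (_root_.map_zero φ)

@[simp] lemma smul_apply (a c : A) (φ : Coind B A M) : (a • φ) c = φ (c * a) := rfl

/-- Functoriality of coinduction. -/
def map (A : Type*) [CommRing A] [Algebra B A] (f : M →ₗ[B] N) :
    Coind B A M →ₗ[A] Coind B A N where
  toFun φ := LinearMap.comp f φ
  map_add' _ _ := LinearMap.comp_add _ _ _
  map_smul' _ _ := rfl

@[simp] lemma map_apply (f : M →ₗ[B] N) (φ : Coind B A M) (a : A) : map A f φ a = f (φ a) := rfl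

end Coind

lemma coind_injective {B A M : Type u} [CommRing B] [CommRing A] [Algebra B A] [AddCommGroup M]
    [Module B M] [Module.Injective B M] : Module.Injective A (Coind B A M) where
  out X Y _ _ _ _ f hf g := by
    let _ : Module B X := Module.compHom X (algebraMap B A)
    let _ : Module B Y := Module.compHom Y (algebraMap B A)
    let f' : X →ₗ[B] Y :=
      { toFun := f, map_add' := f.map_add, map_smul' := fun b x => f.map_smul (algebraMap B A b) x }
    let g' : X →ₗ[B] M :=
      { toFun := fun x => g x 1
        map_add' := fun x y => by simp
        map_smul' := fun b x => by
          change g (algebraMap B A b • x) 1 = b • g x 1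
          rw [LinearMap.map_smul, Coind.smul_apply, one_mul, Algebra.algebraMap_eq_smul_one,
            _root_.map_smul] }
    obtain ⟨h, hh⟩ := Module.Injective.out f' hf g'
    refine ⟨{ toFun := fun y =>
              { toFun := fun a => h (a • y)
                map_add' := fun a b => by rw [add_smul, _root_.map_add]
                map_smul' := fun b a => ?_ }
              map_add' := fun y z => ?_
              map_smul' := fun a y => ?_ }, fun x => ?_⟩
    · rw [RingHom.id_apply, ← h.map_smul, Algebra.smul_def, mul_smul]
      rfl
    · refine Coind.ext fun a => ?_
      change h (a • (y + z)) = h (a • y) + h (a • z)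
      rw [smul_add, _root_.map_add]
    · refine Coind.ext fun c => ?_
      change h (c • a • y) = h ((c * a) • y)
      rw [mul_smul]
    · refine Coind.ext fun a => ?_
      change h (a • f x) = g x a
      have := hh (a • x)
      change h (f (a • x)) = g (a • x) 1 at this
      rw [← f.map_smul, this, LinearMap.map_smul, Coind.smul_apply, one_mul]

lemma coind_hasInjectiveDimensionLE {B A : Type u} [CommRing B] [CommRing A] [Algebra B A]
    [Module.Projective B A] (n : ℕ) (M : ModuleCat.{u} B) [HasInjectiveDimensionLE M n] :
    HasInjectiveDimensionLE (ModuleCat.of A (Coind B A M)) n := by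
  induction n generalizing M with
  | zero =>
    have h : HasInjectiveDimensionLE M 0 := ‹_›
    simp only [HasInjectiveDimensionLE, zero_add, ← injective_iff_hasInjectiveDimensionLT_one]
      at h ⊢
    rw [← Module.injective_iff_injective_object] at h ⊢
    exact coind_injective
  | succ n ih =>
    obtain ⟨I, _, f, _⟩ := EnoughInjectives.presentation M
    have hI : Module.Injective B I := Module.injective_module_of_injective_object B I
    have injf : Function.Injective f.hom := (ModuleCat.mono_iff_injective f).mp ‹_›
    let S : ShortComplex (ModuleCat.{u} B) :=
      ModuleCat.shortComplexOfCompEqZero _ _ f.hom.exact_map_mkQ_range.linearMap_comp_eq_zero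
    have exactS := ModuleCat.shortComplex_shortExact S
      f.hom.exact_map_mkQ_range injf (Submodule.mkQ_surjective _)
    have ex : Function.Exact (Coind.map A f.hom) (Coind.map A f.hom.range.mkQ) := by
      intro φ
      constructor
      · intro h
        have h' (a : A) : φ a ∈ f.hom.range := by
          rw [← Submodule.Quotient.mk_eq_zero]
          exact DFunLike.congr_fun h a
        refine ⟨LinearMap.comp (LinearEquiv.ofInjective f.hom injf).symm.toLinearMap
          (LinearMap.codRestrict f.hom.range φ h'), ?_⟩
        ext a
        exact LinearEquiv.ofInjective_symm_apply (f := f.hom) (h := injf) (⟨φ a, h' a⟩ : f.hom.range)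
      · rintro ⟨ψ, rfl⟩
        ext a
        simp
    let S' : ShortComplex (ModuleCat.{u} A) :=
      ModuleCat.shortComplexOfCompEqZero _ _ ex.linearMap_comp_eq_zero
    have exactS' := ModuleCat.shortComplex_shortExact S' ex
      (fun φ ψ h => Coind.ext fun a => injf (DFunLike.congr_fun h a))
      (fun φ => by
        obtain ⟨ψ, hψ⟩ := Module.projective_lifting_property f.hom.range.mkQ
          (show A →ₗ[B] _ from φ) (Submodule.mkQ_surjective _)
        exact ⟨ψ, hψ⟩)
    have : Injective S'.X₂ := by
      rw [← Module.injective_iff_injective_object]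
      exact coind_injective
    have : Injective S.X₂ := ‹Injective I›
    have := (exactS.hasInjectiveDimensionLT_X₃_iff n inferInstance).2 ‹HasInjectiveDimensionLE M _›
    exact (exactS'.hasInjectiveDimensionLT_X₃_iff n inferInstance).1 (@ih S.X₃ this)

end Coinduced

section Hilbert

open scoped Polynomial in
lemma polynomial_hasInjectiveDimensionLE {R : Type u} [CommRing R] (m : ℕ)
    (h : ∀ M : ModuleCat.{u} R, HasInjectiveDimensionLE M m) (N : ModuleCat.{u} R[X]) :
    HasInjectiveDimensionLE N (m + 1) := by
  let _ : Module R N := Module.compHom N (Polynomial.C : R →+* R[X])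
  have hC (r : R) (x : N) : r • x = (Polynomial.C r : R[X]) • x := rfl
  let f : N →ₗ[R[X]] Coind R R[X] N :=
    { toFun := fun x =>
        { toFun := fun p => p • x
          map_add' := fun p q => add_smul p q x
          map_smul' := fun r p => by
            rw [RingHom.id_apply, hC, smul_smul, Polynomial.smul_eq_C_mul] }
      map_add' := fun x y => Coind.ext fun p => smul_add p x y
      map_smul' := fun q x => Coind.ext fun p => (mul_smul p q x).symm }
  have hf (x : N) (p : R[X]) : f x p = p • x := rfl
  let g : Coind R R[X] N →ₗ[R[X]] Coind R R[X] N :=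
    { toFun := fun φ =>
        { toFun := fun p => φ (p * Polynomial.X) - (Polynomial.X : R[X]) • φ p
          map_add' := fun p q => by
            rw [add_mul, _root_.map_add, _root_.map_add, smul_add]; abel
          map_smul' := fun r p => by
            rw [smul_mul_assoc, _root_.map_smul, _root_.map_smul, RingHom.id_apply, smul_sub,
              hC r ((Polynomial.X : R[X]) • φ p), hC r (φ p), smul_smul, smul_smul,
              mul_comm (Polynomial.X : R[X])] }
      map_add' := fun φ ψ => Coind.ext fun p => by
        change (φ + ψ) (p * Polynomial.X) - (Polynomial.X : R[X]) • (φ + ψ) p =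
          (φ (p * Polynomial.X) - (Polynomial.X : R[X]) • φ p) +
            (ψ (p * Polynomial.X) - (Polynomial.X : R[X]) • ψ p)
        rw [Coind.add_apply, Coind.add_apply, smul_add]; abel
      map_smul' := fun q φ => Coind.ext fun p => by
        change φ (p * Polynomial.X * q) - (Polynomial.X : R[X]) • φ (p * q) =
          φ (p * q * Polynomial.X) - (Polynomial.X : R[X]) • φ (p * q)
        rw [mul_right_comm] }
  have hg (φ : Coind R R[X] N) (p : R[X]) :
      g φ p = φ (p * Polynomial.X) - (Polynomial.X : R[X]) • φ p := rfl
  have injf : Function.Injective f := fun x y hxy => by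
    simpa [hf] using DFunLike.congr_fun hxy (1 : R[X])
  have ex : Function.Exact f g := by
    intro φ
    constructor
    · intro h0
      have h1 (p : R[X]) : φ (p * Polynomial.X) = (Polynomial.X : R[X]) • φ p :=
        sub_eq_zero.1 (DFunLike.congr_fun h0 p)
      refine ⟨φ 1, Coind.ext fun p => ?_⟩
      rw [hf]
      induction p using Polynomial.induction_on with
      | C a => rw [← hC, ← _root_.map_smul, Polynomial.smul_eq_C_mul, mul_one]
      | add p q hp hq => rw [add_smul, _root_.map_add, hp, hq]
      | monomial n a hn =>
        rw [pow_succ, ← mul_assoc, h1, ← hn, smul_smul, mul_comm (Polynomial.X : R[X])]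
    · rintro ⟨x, rfl⟩
      refine Coind.ext fun p => ?_
      rw [hg, hf, hf, smul_smul, mul_comm (Polynomial.X : R[X]), sub_self]
      rfl
  have surjg : Function.Surjective g := by
    intro ψ
    let c : ℕ → N := fun n => Nat.rec 0 (fun n x => ψ (Polynomial.X ^ n) + (Polynomial.X : R[X]) • x) n
    refine ⟨((Polynomial.basisMonomials R).constr R c : R[X] →ₗ[R] N), ?_⟩
    have key : ∀ φ : R[X] →ₗ[R] N, (∀ n, φ (Polynomial.X ^ n) = c n) →
        (show R[X] →ₗ[R] N from g φ) = (show R[X] →ₗ[R] N from ψ) := by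
      intro φ hφ
      refine Polynomial.lhom_ext' fun n => LinearMap.ext_ring ?_
      change φ (Polynomial.monomial n 1 * Polynomial.X) -
          (Polynomial.X : R[X]) • φ (Polynomial.monomial n 1) =
        ψ (Polynomial.monomial n 1)
      rw [Polynomial.monomial_one_right_eq_X_pow, ← pow_succ, hφ, hφ]
      exact add_sub_cancel_right _ _
    refine key _ fun n => ?_
    rw [← Polynomial.monomial_one_right_eq_X_pow]
    have := (Polynomial.basisMonomials R).constr_basis R c n
    rwa [Polynomial.coe_basisMonomials] at this
  let S : ShortComplex (ModuleCat.{u} R[X]) :=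
    ModuleCat.shortComplexOfCompEqZero f g ex.linearMap_comp_eq_zero
  have exactS := ModuleCat.shortComplex_shortExact S ex injf surjg
  have : HasInjectiveDimensionLE (ModuleCat.of R N) m := h _
  have hc := coind_hasInjectiveDimensionLE (A := R[X]) m (ModuleCat.of R N)
  have hc' : HasInjectiveDimensionLE (ModuleCat.of R[X] (Coind R R[X] N)) (m + 1) :=
    hasInjectiveDimensionLT_of_ge _ (m + 1) _ (by omega)
  exact exactS.hasInjectiveDimensionLT_X₁ (m + 1) hc hc'

lemma hasInjectiveDimensionLE_of_ringEquiv {R R' : Type u} [CommRing R] [CommRing R']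
    (e : R ≃+* R') (m : ℕ) (h : ∀ M : ModuleCat.{u} R, HasInjectiveDimensionLE M m)
    (N : ModuleCat.{u} R') : HasInjectiveDimensionLE N m := by
  let _ : RingHomInvPair (RingHomClass.toRingHom e) (RingHomClass.toRingHom e.symm) :=
    RingHomInvPair.of_ringEquiv e
  let _ : RingHomInvPair (RingHomClass.toRingHom e.symm) (RingHomClass.toRingHom e) :=
    RingHomInvPair.of_ringEquiv e.symm
  let M : ModuleCat.{u} R :=
    let := Module.compHom N e.toRingHom
    ModuleCat.of R N
  let eM : M ≃ₛₗ[RingHomClass.toRingHom e] N :=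
    { __ := AddEquiv.refl M
      map_smul' := fun r x => rfl }
  exact (ModuleCat.hasInjectiveDimensionLE_iff_of_semiLinearEquiv e eM m).1 (h M)

lemma field_hasInjectiveDimensionLE (F : Type u) [Field F] (M : ModuleCat.{u} F) :
    HasInjectiveDimensionLE M 0 := by
  simp only [HasInjectiveDimensionLE, zero_add, ← injective_iff_hasInjectiveDimensionLT_one]
  rw [← Module.injective_iff_injective_object]
  exact Module.injective_of_isSemisimpleRing F M

lemma mvPolynomial_fin_hasInjectiveDimensionLE (F : Type u) [Field F] (n : ℕ)
    (M : ModuleCat.{u} (MvPolynomial (Fin n) F)) : HasInjectiveDimensionLE M n := by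
  induction n with
  | zero =>
    exact hasInjectiveDimensionLE_of_ringEquiv (MvPolynomial.isEmptyRingEquiv F (Fin 0)).symm 0
      (field_hasInjectiveDimensionLE F) M
  | succ n ih =>
    exact hasInjectiveDimensionLE_of_ringEquiv (MvPolynomial.finSuccEquiv F n).toRingEquiv.symm
      (n + 1) (polynomial_hasInjectiveDimensionLE n ih) M

end Hilbert

section Gorenstein

lemma isGorensteinRing_of_hasInjectiveDimensionLE {A : Type u} [CommRing A] [IsNoetherianRing A]
    (n : ℕ) (h : HasInjectiveDimensionLE (ModuleCat.of A A) n) : IsGorensteinRing A := by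
  refine ⟨‹_›, fun P _ => (hasFiniteInjectiveDimension_iff _).2 ⟨n, ?_⟩⟩
  have h1 := ModuleCat.localizedModule_hasInjectiveDimensionLE n P.primeCompl (ModuleCat.of A A)
  have _ : Small.{u} (Localization P.primeCompl) := inferInstance
  have e1 : Localization.AtPrime P ≃ₗ[Localization P.primeCompl]
      LocalizedModule P.primeCompl A :=
    LinearEquiv.extendScalarsOfIsLocalization P.primeCompl (Localization P.primeCompl)
      (IsLocalizedModule.linearEquiv P.primeCompl
        (Algebra.linearMap A (Localization P.primeCompl))
        (LocalizedModule.mkLinearMap P.primeCompl A))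
  have e2 : LocalizedModule P.primeCompl A ≃ₗ[Localization P.primeCompl]
      (ModuleCat.of A A).localizedModule P.primeCompl :=
    (Shrink.linearEquiv (Localization P.primeCompl) (LocalizedModule P.primeCompl A)).symm
  exact (ModuleCat.hasInjectiveDimensionLE_iff_of_linearEquiv
    (M := ModuleCat.of (Localization P.primeCompl) (Localization.AtPrime P)) (e1.trans e2) n).2 h1

/-- A monogenic free algebra `B[w]/(w ^ m - t)` is isomorphic to its dual. -/
lemma exists_linearEquiv_coind {B A : Type*} [CommRing B] [CommRing A] [Algebra B A] {m : ℕ}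
    (w : A) (t : B) (hw : w ^ (m + 1) = algebraMap B A t) (b : Module.Basis (Fin (m + 1)) B A)
    (hb : ∀ i, b i = w ^ (i : ℕ)) : Nonempty (A ≃ₗ[A] Coind B A B) := by
  let l : A →ₗ[B] B := b.coord (Fin.last m)
  let e : A →ₗ[A] Coind B A B :=
    { toFun := fun a => l.comp (LinearMap.mulRight B a)
      map_add' := fun a c => Coind.ext fun x => by
        change l (x * (a + c)) = l (x * a) + l (x * c)
        rw [mul_add, _root_.map_add]
      map_smul' := fun a c => Coind.ext fun x => by
        change l (x * (a * c)) = l (x * a * c)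
        rw [mul_assoc] }
  have he (a x : A) : e a x = l (x * a) := rfl
  have key (i : Fin (m + 1)) (a : A) : l (w ^ (m - i : ℕ) * a) = b.coord i a := by
    suffices l.comp (LinearMap.mulLeft B (w ^ (m - i : ℕ))) = b.coord i from
      LinearMap.congr_fun this a
    refine b.ext fun j => ?_
    change l (w ^ (m - i : ℕ) * b j) = b.coord i (b j)
    rw [hb j, ← pow_add]
    have hi := i.is_lt
    have hj := j.is_lt
    rcases le_or_gt (j : ℕ) i with hji | hji
    · have hk : m - i + j < m + 1 := by omega
      have h1 : w ^ (m - i + j : ℕ) = b ⟨m - i + j, hk⟩ := (hb ⟨m - i + j, hk⟩).symm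
      rw [h1, ← hb j]
      simp only [l, Module.Basis.coord_apply, Module.Basis.repr_self, Finsupp.single_apply,
        Fin.ext_iff, Fin.val_last]
      congr 1
      simp only [eq_iff_iff]
      omega
    · obtain ⟨k, hk⟩ : ∃ k, m - i + j = (m + 1) + k := ⟨j - i - 1, by omega⟩
      have hkm : k < m + 1 := by omega
      have h1 : w ^ k = b ⟨k, hkm⟩ := (hb ⟨k, hkm⟩).symm
      rw [hk, pow_add, hw, ← Algebra.smul_def, _root_.map_smul, h1, ← hb j]
      simp only [l, Module.Basis.coord_apply, Module.Basis.repr_self, Finsupp.single_apply,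
        Fin.ext_iff, Fin.val_last]
      rw [if_neg (by omega), if_neg (by omega), smul_zero]
  refine ⟨LinearEquiv.ofBijective e ⟨?_, ?_⟩⟩
  · intro a c hac
    refine b.ext_elem fun i => ?_
    rw [← b.coord_apply, ← b.coord_apply, ← key i a, ← key i c, ← he, ← he, hac]
  · intro φ
    refine ⟨∑ j : Fin (m + 1), φ (w ^ (m - j : ℕ)) • b j, ?_⟩
    refine DFunLike.coe_injective (congrArg DFunLike.coe
      (b.ext (f₁ := (show A →ₗ[B] B from e _)) (f₂ := (show A →ₗ[B] B from φ)) fun i => ?_))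
    have hi := i.is_lt
    change l (b i * ∑ j : Fin (m + 1), φ (w ^ (m - j : ℕ)) • b j) = φ (b i)
    have h1 : b i = w ^ (m - (⟨m - i, by omega⟩ : Fin (m + 1)) : ℕ) := by
      rw [hb]
      congr 1
      simp only
      omega
    rw [h1, key, b.coord_apply, b.repr_sum_self]

lemma isGorensteinRing_of_basis_pow {F : Type u} [Field F] {n : ℕ} {A : Type u} [CommRing A]
    [Algebra (MvPolynomial (Fin n) F) A] {m : ℕ} (w : A) (t : MvPolynomial (Fin n) F)
    (hw : w ^ (m + 1) = algebraMap _ A t)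
    (b : Module.Basis (Fin (m + 1)) (MvPolynomial (Fin n) F) A)
    (hb : ∀ i, b i = w ^ (i : ℕ)) : IsGorensteinRing A := by
  have _ : Module.Free (MvPolynomial (Fin n) F) A := Module.Free.of_basis b
  have _ : Module.Finite (MvPolynomial (Fin n) F) A := Module.Finite.of_basis b
  have _ : IsNoetherianRing A := IsNoetherianRing.of_finite (MvPolynomial (Fin n) F) A
  obtain ⟨e⟩ := exists_linearEquiv_coind w t hw b hb
  have := mvPolynomial_fin_hasInjectiveDimensionLE F n
    (ModuleCat.of (MvPolynomial (Fin n) F) (MvPolynomial (Fin n) F))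
  have h := coind_hasInjectiveDimensionLE (A := A) n
    (ModuleCat.of (MvPolynomial (Fin n) F) (MvPolynomial (Fin n) F))
  exact isGorensteinRing_of_hasInjectiveDimensionLE n
    ((ModuleCat.hasInjectiveDimensionLE_iff_of_linearEquiv (M := ModuleCat.of A A) e n).2 h)

end Gorenstein

section Cut

variable {R S : Type u} [CommRing R] [CommRing S] [Algebra R S]

lemma Coind.exists_apply_one {M : Type*} [AddCommGroup M] [Module R M] {f : R}
    (hπ : Function.Surjective (algebraMap R S)) (hker : RingHom.ker (algebraMap R S) = Ideal.span {f})
    (x : M) (hx : f • x = 0) : ∃ φ : Coind R S M, φ 1 = x := by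
  have hker' : LinearMap.ker (Algebra.linearMap R S) ≤
      LinearMap.ker (LinearMap.toSpanSingleton R M x) := by
    intro r hr
    have : r ∈ RingHom.ker (algebraMap R S) := hr
    rw [hker, Ideal.mem_span_singleton] at this
    obtain ⟨c, rfl⟩ := this
    rw [LinearMap.mem_ker, LinearMap.toSpanSingleton_apply, mul_comm, mul_smul, hx, smul_zero]
  let e := (Algebra.linearMap R S).quotKerEquivOfSurjective hπ
  refine ⟨((LinearMap.ker (Algebra.linearMap R S)).liftQ _ hker').comp e.symm.toLinearMap, ?_⟩
  have h1 : e.symm 1 = Submodule.Quotient.mk 1 := by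
    rw [LinearEquiv.symm_apply_eq]
    exact (RingHom.map_one (algebraMap R S)).symm
  change ((LinearMap.ker (Algebra.linearMap R S)).liftQ _ hker') (e.symm 1) = x
  rw [h1, Submodule.liftQ_apply, LinearMap.toSpanSingleton_apply, one_smul]

lemma Coind.apply_algebraMap {M : Type*} [AddCommGroup M] [Module R M] (φ : Coind R S M) (r : R) :
    φ (algebraMap R S r) = r • φ 1 := by
  rw [Algebra.algebraMap_eq_smul_one, _root_.map_smul]

lemma Coind.ext_one {M : Type*} [AddCommGroup M] [Module R M]
    (hπ : Function.Surjective (algebraMap R S)) {φ ψ : Coind R S M} (h : φ 1 = ψ 1) : φ = ψ := by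
  refine Coind.ext fun s => ?_
  obtain ⟨r, rfl⟩ := hπ s
  rw [Coind.apply_algebraMap, Coind.apply_algebraMap, h]

lemma Coind.smul_apply_one {M : Type*} [AddCommGroup M] [Module R M] {f : R}
    (hker : RingHom.ker (algebraMap R S) = Ideal.span {f}) (φ : Coind R S M) : f • φ 1 = 0 := by
  rw [← Coind.apply_algebraMap, show algebraMap R S f = 0 from ?_, _root_.map_zero]
  rw [← RingHom.mem_ker, hker]
  exact Ideal.mem_span_singleton_self f

lemma exists_smul_eq_of_injective {M : Type u} [AddCommGroup M] [Module R M]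
    [Module.Injective R M] {f : R} (hf : ∀ x, f * x = 0 → x = 0) (x : M) : ∃ y, f • y = x := by
  obtain ⟨h, hh⟩ := Module.Injective.out (LinearMap.mulLeft R f)
    ((injective_iff_map_eq_zero _).2 hf) (LinearMap.toSpanSingleton R M x)
  refine ⟨h 1, ?_⟩
  have := hh 1
  rw [LinearMap.mulLeft_apply, mul_one, LinearMap.toSpanSingleton_apply, one_smul] at this
  rw [← this, ← _root_.map_smul, smul_eq_mul, mul_one]

lemma coind_hasInjectiveDimensionLE_of_divisible {f : R}
    (hπ : Function.Surjective (algebraMap R S)) (hker : RingHom.ker (algebraMap R S) = Ideal.span {f})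
    (hf : ∀ x, f * x = 0 → x = 0) (n : ℕ) (M : ModuleCat.{u} R) (hM : ∀ x : M, ∃ y, f • y = x)
    [HasInjectiveDimensionLE M n] :
    HasInjectiveDimensionLE (ModuleCat.of S (Coind R S M)) n := by
  induction n generalizing M with
  | zero =>
    have h : HasInjectiveDimensionLE M 0 := ‹_›
    simp only [HasInjectiveDimensionLE, zero_add, ← injective_iff_hasInjectiveDimensionLT_one]
      at h ⊢
    rw [← Module.injective_iff_injective_object] at h ⊢
    exact coind_injective
  | succ n ih =>
    obtain ⟨I, _, i, _⟩ := EnoughInjectives.presentation M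
    have hI : Module.Injective R I := Module.injective_module_of_injective_object R I
    have injf : Function.Injective i.hom := (ModuleCat.mono_iff_injective i).mp ‹_›
    let T : ShortComplex (ModuleCat.{u} R) :=
      ModuleCat.shortComplexOfCompEqZero _ _ i.hom.exact_map_mkQ_range.linearMap_comp_eq_zero
    have exactT := ModuleCat.shortComplex_shortExact T
      i.hom.exact_map_mkQ_range injf (Submodule.mkQ_surjective _)
    have ex : Function.Exact (Coind.map S i.hom) (Coind.map S i.hom.range.mkQ) := by
      intro φ
      constructor
      · intro h
        have h' : φ 1 ∈ i.hom.range := by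
          rw [← Submodule.Quotient.mk_eq_zero]
          exact DFunLike.congr_fun h (1 : S)
        obtain ⟨x, hx⟩ := h'
        obtain ⟨ψ, hψ⟩ := Coind.exists_apply_one hπ hker x (injf (by
          rw [_root_.map_smul, hx, Coind.smul_apply_one hker, _root_.map_zero]))
        exact ⟨ψ, Coind.ext_one hπ (by rw [Coind.map_apply, hψ, hx])⟩
      · rintro ⟨ψ, rfl⟩
        ext a
        simp
    let T' : ShortComplex (ModuleCat.{u} S) :=
      ModuleCat.shortComplexOfCompEqZero _ _ ex.linearMap_comp_eq_zero
    have exactT' := ModuleCat.shortComplex_shortExact T' ex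
      (fun φ ψ h => Coind.ext fun a => injf (DFunLike.congr_fun h a))
      (fun φ => by
        obtain ⟨j, hj⟩ := Submodule.mkQ_surjective _ (φ 1)
        have h0 : i.hom.range.mkQ (f • j) = 0 := by
          rw [_root_.map_smul, hj, Coind.smul_apply_one hker]
        obtain ⟨x, hx⟩ := (i.hom.exact_map_mkQ_range (f • j)).1 h0
        obtain ⟨y, rfl⟩ := hM x
        obtain ⟨ψ, hψ⟩ := Coind.exists_apply_one hπ hker (j - i.hom y) (by
          rw [smul_sub, ← hx, _root_.map_smul, sub_self])
        refine ⟨ψ, Coind.ext_one hπ ?_⟩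
        change i.hom.range.mkQ (ψ 1) = φ 1
        have h1 : i.hom.range.mkQ (i.hom y) = 0 := (i.hom.exact_map_mkQ_range (i.hom y)).2 ⟨y, rfl⟩
        rw [hψ, _root_.map_sub, h1, hj, sub_zero])
    have : Injective T'.X₂ := by
      rw [← Module.injective_iff_injective_object]
      exact coind_injective
    have : Injective T.X₂ := ‹Injective I›
    have := (exactT.hasInjectiveDimensionLT_X₃_iff n inferInstance).2 ‹HasInjectiveDimensionLE M _›
    refine (exactT'.hasInjectiveDimensionLT_X₃_iff n inferInstance).1 (@ih T.X₃ (fun x => ?_) this)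
    obtain ⟨j, rfl⟩ := Submodule.mkQ_surjective i.hom.range x
    obtain ⟨y, rfl⟩ := exists_smul_eq_of_injective hf j
    exact ⟨i.hom.range.mkQ y, (_root_.map_smul _ _ _).symm⟩

/-- Finite self-injective dimension passes to the quotient by a nonzerodivisor. -/
lemma hasInjectiveDimensionLE_of_ker_eq_span {f : R}
    (hπ : Function.Surjective (algebraMap R S)) (hker : RingHom.ker (algebraMap R S) = Ideal.span {f})
    (hf : ∀ x, f * x = 0 → x = 0) (n : ℕ) (h : HasInjectiveDimensionLE (ModuleCat.of R R) n) :
    HasInjectiveDimensionLE (ModuleCat.of S S) n := by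
  obtain ⟨I, _, i, _⟩ := EnoughInjectives.presentation (ModuleCat.of R R)
  have hI : Module.Injective R I := Module.injective_module_of_injective_object R I
  have injf : Function.Injective i.hom := (ModuleCat.mono_iff_injective i).mp ‹_›
  let T : ShortComplex (ModuleCat.{u} R) :=
    ModuleCat.shortComplexOfCompEqZero _ _ i.hom.exact_map_mkQ_range.linearMap_comp_eq_zero
  have exactT := ModuleCat.shortComplex_shortExact T
    i.hom.exact_map_mkQ_range injf (Submodule.mkQ_surjective _)
  have hdiv := exists_smul_eq_of_injective (M := I) hf
  have : Injective T.X₂ := ‹Injective I›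
  have hC : HasInjectiveDimensionLE T.X₃ n :=
    (exactT.hasInjectiveDimensionLT_X₃_iff n inferInstance).2
      (hasInjectiveDimensionLT_of_ge _ (n + 1) _ (by omega))
  have hC' := coind_hasInjectiveDimensionLE_of_divisible hπ hker hf n T.X₃ (fun x => by
    obtain ⟨j, rfl⟩ := Submodule.mkQ_surjective i.hom.range x
    obtain ⟨y, rfl⟩ := hdiv j
    exact ⟨i.hom.range.mkQ y, (_root_.map_smul _ _ _).symm⟩)
  let α : Coind R S I →ₗ[S] Coind R S T.X₃ := Coind.map S i.hom.range.mkQ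
  have hα (φ : Coind R S I) (s : S) : α φ s = i.hom.range.mkQ (φ s) := rfl
  have hmk (x : I) : i.hom.range.mkQ x = 0 ↔ ∃ r : R, i.hom r = x :=
    i.hom.exact_map_mkQ_range x
  have injα : Function.Injective α := by
    rw [injective_iff_map_eq_zero]
    intro φ hφ
    obtain ⟨r, hr⟩ := (hmk (φ 1)).1 (DFunLike.congr_fun hφ (1 : S))
    have h1 := Coind.smul_apply_one hker φ
    rw [← hr, ← _root_.map_smul] at h1
    have h2 : f * r = 0 := injf (h1.trans (_root_.map_zero _).symm)
    refine Coind.ext_one hπ ?_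
    rw [← hr, hf r h2]
    exact _root_.map_zero i.hom
  let U : ShortComplex (ModuleCat.{u} S) :=
    ModuleCat.shortComplexOfCompEqZero α α.range.mkQ α.exact_map_mkQ_range.linearMap_comp_eq_zero
  have exactU := ModuleCat.shortComplex_shortExact U
    α.exact_map_mkQ_range injα (Submodule.mkQ_surjective _)
  have : Injective U.X₁ := by
    rw [← Module.injective_iff_injective_object]
    exact coind_injective
  have hE : HasInjectiveDimensionLE (ModuleCat.of S (Coind R S T.X₃ ⧸ α.range)) n :=
    exactU.hasInjectiveDimensionLT_X₃ (n + 1) hC'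
      (hasInjectiveDimensionLT_of_ge U.X₁ 1 (n + 2) (by omega))
  obtain ⟨y, hy⟩ := hdiv (i.hom (1 : R))
  obtain ⟨φ₀, hφ₀⟩ := Coind.exists_apply_one (S := S) hπ hker (i.hom.range.mkQ y) (by
    rw [← _root_.map_smul, hy]
    exact (hmk _).2 ⟨1, rfl⟩)
  let β : S →ₗ[S] Coind R S T.X₃ ⧸ α.range := LinearMap.toSpanSingleton S _ (α.range.mkQ φ₀)
  have hβ (r : R) : β (algebraMap R S r) = α.range.mkQ (algebraMap R S r • φ₀) := rfl
  have h1φ (r : R) : (algebraMap R S r • φ₀) 1 = i.hom.range.mkQ (r • y) := by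
    rw [Coind.smul_apply, one_mul, Coind.apply_algebraMap, hφ₀, _root_.map_smul]
  have hi (r : R) : i.hom r = r • i.hom (1 : R) := by
    rw [← _root_.map_smul]
    exact congrArg _ (mul_one r).symm
  have bij : Function.Bijective β := by
    constructor
    · rw [injective_iff_map_eq_zero]
      intro s hs
      obtain ⟨r, rfl⟩ := hπ s
      rw [hβ] at hs
      obtain ⟨φ, hφ⟩ := (α.exact_map_mkQ_range _).1 hs
      have h1 := DFunLike.congr_fun hφ (1 : S)
      rw [h1φ, hα] at h1
      have h2 : i.hom.range.mkQ (r • y - φ 1) = 0 := by rw [_root_.map_sub, h1, sub_self]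
      obtain ⟨r', hr'⟩ := (hmk _).1 h2
      have h3 : i.hom (f * r') = i.hom r := by
        rw [show f * r' = f • r' from rfl, _root_.map_smul, hr', smul_sub,
          Coind.smul_apply_one hker, sub_zero, smul_comm, hy, hi r]
      rw [← RingHom.mem_ker, hker, ← injf h3]
      exact Ideal.mul_mem_right _ _ (Ideal.mem_span_singleton_self f)
    · intro e
      obtain ⟨φ, rfl⟩ := Submodule.mkQ_surjective _ e
      obtain ⟨j, hj⟩ := Submodule.mkQ_surjective i.hom.range (φ 1)
      obtain ⟨r, hr⟩ := (hmk (f • j)).1 (by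
        rw [_root_.map_smul, hj]
        exact Coind.smul_apply_one hker φ)
      obtain ⟨ψ, hψ⟩ := Coind.exists_apply_one (S := S) hπ hker (j - r • y) (by
        rw [smul_sub, ← hr, smul_comm, hy, hi r, sub_self])
      refine ⟨algebraMap R S r, ?_⟩
      have : φ = algebraMap R S r • φ₀ + α ψ := by
        refine Coind.ext_one hπ ?_
        rw [Coind.add_apply, h1φ, hα, hψ, ← _root_.map_add, add_sub_cancel]
        exact hj.symm
      rw [hβ, this, _root_.map_add]
      have h0 : α.range.mkQ (α ψ) = 0 := (α.exact_map_mkQ_range _).2 ⟨ψ, rfl⟩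
      rw [h0, add_zero]
  exact (ModuleCat.hasInjectiveDimensionLE_iff_of_linearEquiv (M := ModuleCat.of S S)
    (N := ModuleCat.of S (Coind R S T.X₃ ⧸ α.range)) (LinearEquiv.ofBijective β bij) n).2 hE

end Cut

section Socle

open Abelian

variable {Q : Type u} [CommRing Q] [IsNoetherianRing Q]

lemma ext_subsingleton_of_finite {m : Ideal Q} {N : ℕ} (hm : m.IsMaximal) (hN : m ^ N = ⊥) {s : Q}
    (hs : ∀ a, a * s = 0 ↔ a ∈ m) {j : ℕ}
    (h : ∀ (M : Type u) [AddCommGroup M] [Module Q M] [Module.Finite Q M],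
      Subsingleton (Ext (ModuleCat.of Q M) (ModuleCat.of Q Q) (j + 2)))
    (M : Type u) [AddCommGroup M] [Module Q M] [hM : Module.Finite Q M] :
    Subsingleton (Ext (ModuleCat.of Q M) (ModuleCat.of Q Q) (j + 1)) := by
  induction hM using IsNoetherianRing.induction_on_isQuotientEquivQuotientPrime Q with
  | subsingleton N =>
    have h0 : Limits.IsZero (ModuleCat.of Q N) := ModuleCat.isZero_of_subsingleton _
    refine subsingleton_of_forall_eq 0 fun x => ?_
    rw [← Ext.mk₀_id_comp x, h0.eq_of_src (𝟙 _) 0, Ext.mk₀_zero, Ext.zero_comp]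
  | quotient N p e =>
    have hp : p.1 = m := by
      refine (hm.eq_of_le p.2.ne_top ?_).symm
      exact p.2.le_of_pow_le (hN.trans_le bot_le)
    have hker : LinearMap.ker (LinearMap.toSpanSingleton Q Q s) = p.1 := by
      ext a
      rw [hp, LinearMap.mem_ker, LinearMap.toSpanSingleton_apply, smul_eq_mul, hs]
    let g : N →ₗ[Q] Q := (p.1.liftQ _ hker.ge).comp e.toLinearMap
    have hg : Function.Injective g :=
      (LinearMap.ker_eq_bot.1 (Submodule.ker_liftQ_eq_bot _ _ hker.ge hker.le)).comp e.injective
    let T : ShortComplex (ModuleCat.{u} Q) :=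
      ModuleCat.shortComplexOfCompEqZero g g.range.mkQ g.exact_map_mkQ_range.linearMap_comp_eq_zero
    have exactT : T.ShortExact := ModuleCat.shortComplex_shortExact T
      g.exact_map_mkQ_range hg (Submodule.mkQ_surjective _)
    refine subsingleton_of_forall_eq 0 fun x => ?_
    obtain ⟨y, rfl⟩ := Ext.contravariant_sequence_exact₁ exactT (ModuleCat.of Q Q) x
      (show 1 + (j + 1) = j + 2 by omega) (@Subsingleton.elim _ (h (Q ⧸ g.range)) _ _)
    rw [Ext.eq_zero_of_projective (P := T.X₂) y, Ext.comp_zero]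
  | exact N₁ N₂ N₃ f g hf hg hfg h₁ h₃ =>
    let T : ShortComplex (ModuleCat.{u} Q) :=
      ModuleCat.shortComplexOfCompEqZero f g hfg.linearMap_comp_eq_zero
    have exactT : T.ShortExact := ModuleCat.shortComplex_shortExact T hfg hf hg
    refine subsingleton_of_forall_eq 0 fun x => ?_
    obtain ⟨y, rfl⟩ := Ext.contravariant_sequence_exact₂ exactT (ModuleCat.of Q Q) x
      (@Subsingleton.elim _ h₁ _ _)
    rw [@Subsingleton.elim _ h₃ y 0, Ext.comp_zero]

/-- A Noetherian ring with nilpotent maximal ideal whose socle contains two independent elements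
has infinite self-injective dimension. -/
lemma not_hasInjectiveDimensionLE_of_socle {m : Ideal Q} {N : ℕ} (hm : m.IsMaximal)
    (hN : m ^ N = ⊥) {s t : Q} (hst : ∀ a b, a * s + b * t = 0 ↔ a ∈ m ∧ b ∈ m) (n : ℕ) :
    ¬ HasInjectiveDimensionLE (ModuleCat.of Q Q) n := by
  intro hn
  have hs (a : Q) : a * s = 0 ↔ a ∈ m := by simpa using hst a 0
  have h1 : ∀ k, ∀ (M : Type u) [AddCommGroup M] [Module Q M] [Module.Finite Q M],
      Subsingleton (Ext (ModuleCat.of Q M) (ModuleCat.of Q Q) (n - k + 1)) := by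
    intro k
    induction k with
    | zero =>
      intro M _ _ _
      exact subsingleton_of_forall_eq 0 fun x => x.eq_zero_of_hasInjectiveDimensionLT (n + 1) le_rfl
    | succ k ih =>
      intro M _ _ _
      rcases Nat.lt_or_ge k n with hk | hk
      · refine ext_subsingleton_of_finite hm hN hs (j := n - (k + 1)) ?_ M
        rwa [show n - (k + 1) + 2 = n - k + 1 by omega]
      · have := ih M
        rwa [show n - (k + 1) + 1 = n - k + 1 by omega]
  have h2 := h1 n
  rw [Nat.sub_self, zero_add] at h2
  let g : (Q ⧸ m) × (Q ⧸ m) →ₗ[Q] Q :=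
    LinearMap.coprod (m.liftQ (LinearMap.toSpanSingleton Q Q s) fun a ha => (hs a).2 ha)
      (m.liftQ (LinearMap.toSpanSingleton Q Q t) fun a ha => by
        have := (hst 0 a).2 ⟨m.zero_mem, ha⟩
        simpa using this)
  have hg (a b : Q) : g (Ideal.Quotient.mk m a, Ideal.Quotient.mk m b) = a * s + b * t := rfl
  have injg : Function.Injective g := by
    rw [injective_iff_map_eq_zero]
    rintro ⟨a, b⟩ h
    obtain ⟨a, rfl⟩ := Ideal.Quotient.mk_surjective a
    obtain ⟨b, rfl⟩ := Ideal.Quotient.mk_surjective b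
    rw [hg, hst] at h
    rw [Ideal.Quotient.eq_zero_iff_mem.2 h.1, Ideal.Quotient.eq_zero_iff_mem.2 h.2]
    rfl
  let T : ShortComplex (ModuleCat.{u} Q) :=
    ModuleCat.shortComplexOfCompEqZero g g.range.mkQ g.exact_map_mkQ_range.linearMap_comp_eq_zero
  have exactT : T.ShortExact := ModuleCat.shortComplex_shortExact T
    g.exact_map_mkQ_range injg (Submodule.mkQ_surjective _)
  let c : (Q ⧸ m) × (Q ⧸ m) →ₗ[Q] Q := g.comp (LinearMap.prod (LinearMap.fst Q _ _) 0)
  have hc (a b : Q) : c (Ideal.Quotient.mk m a, Ideal.Quotient.mk m b) = a * s := by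
    change g (Ideal.Quotient.mk m a, Ideal.Quotient.mk m 0) = a * s
    rw [hg]; ring
  obtain ⟨y, hy⟩ := Ext.contravariant_sequence_exact₁ exactT (ModuleCat.of Q Q)
    (Ext.mk₀ (ModuleCat.ofHom c : T.X₁ ⟶ ModuleCat.of Q Q)) (show 1 + 0 = 1 by omega)
    (@Subsingleton.elim _ (h2 (Q ⧸ g.range)) _ _)
  obtain ⟨φ, rfl⟩ := (Ext.mk₀_bijective T.X₂ (ModuleCat.of Q Q)).2 y
  rw [Ext.mk₀_comp_mk₀] at hy
  have h3 := (Ext.mk₀_bijective _ _).1 hy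
  have h4 (a b : Q) : φ.hom (a * s + b * t) = a * s := by
    rw [← hg a b, ← hc a b]
    exact LinearMap.congr_fun (congrArg ModuleCat.Hom.hom h3)
      (Ideal.Quotient.mk m a, Ideal.Quotient.mk m b)
  have h5 (x : Q) : φ.hom x = x * φ.hom (1 : Q) := by
    have := φ.hom.map_smul x (1 : Q)
    rwa [smul_eq_mul, mul_one] at this
  have h6 := h4 0 1
  rw [h5, zero_mul, zero_add, one_mul, mul_comm] at h6
  have h7 : φ.hom (1 : Q) ∈ m := ((hst 0 _).1 (by rw [zero_mul, zero_add, h6])).2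
  have h8 := h4 1 0
  rw [h5, zero_mul, add_zero, one_mul, mul_comm, (hs _).2 h7] at h8
  exact hm.ne_top ((Ideal.eq_top_iff_one m).2 ((hs 1).1 (by rw [one_mul, ← h8])))

end Socle

section Criterion

lemma hasInjectiveDimensionLE_quotient_sup {R : Type u} [CommRing R] (I : Ideal R) (f : R)
    (hf : ∀ x, f * x ∈ I → x ∈ I) (n : ℕ)
    (h : HasInjectiveDimensionLE (ModuleCat.of (R ⧸ I) (R ⧸ I)) n) :
    HasInjectiveDimensionLE
      (ModuleCat.of (R ⧸ (I ⊔ Ideal.span {f})) (R ⧸ (I ⊔ Ideal.span {f}))) n := by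
  let π : R ⧸ I →+* R ⧸ (I ⊔ Ideal.span {f}) := Ideal.Quotient.factor le_sup_left
  let _ : Algebra (R ⧸ I) (R ⧸ (I ⊔ Ideal.span {f})) := π.toAlgebra
  refine hasInjectiveDimensionLE_of_ker_eq_span (f := Ideal.Quotient.mk I f)
    (Ideal.Quotient.factor_surjective le_sup_left) ?_ ?_ n h
  · ext x
    obtain ⟨x, rfl⟩ := Ideal.Quotient.mk_surjective x
    rw [RingHom.mem_ker, RingHom.algebraMap_toAlgebra, Ideal.Quotient.factor_mk,
      Ideal.Quotient.eq_zero_iff_mem, Ideal.mem_span_singleton, Submodule.mem_sup]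
    constructor
    · rintro ⟨y, hy, z, hz, rfl⟩
      obtain ⟨c, rfl⟩ := Ideal.mem_span_singleton.1 hz
      rw [_root_.map_add, Ideal.Quotient.eq_zero_iff_mem.2 hy, zero_add, _root_.map_mul]
      exact dvd_mul_right _ _
    · rintro ⟨c, hc⟩
      obtain ⟨c, rfl⟩ := Ideal.Quotient.mk_surjective c
      rw [← _root_.map_mul, Ideal.Quotient.eq] at hc
      exact ⟨_, hc, _, Ideal.mul_mem_right c _ (Ideal.mem_span_singleton_self f), by ring⟩
  · intro x hx
    obtain ⟨x, rfl⟩ := Ideal.Quotient.mk_surjective x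
    rw [← _root_.map_mul, Ideal.Quotient.eq_zero_iff_mem] at hx
    exact Ideal.Quotient.eq_zero_iff_mem.2 (hf x hx)

variable {A : Type u} [CommRing A] (m : Ideal A) [hm : m.IsMaximal]

lemma mk'_mem_map_iff (J : Ideal A) (a : A) (s : m.primeCompl) :
    IsLocalization.mk' (Localization.AtPrime m) a s ∈ J.map (algebraMap A (Localization.AtPrime m))
      ↔ ∃ t ∉ m, t * a ∈ J := by
  rw [IsLocalization.mk'_mem_map_algebraMap_iff m.primeCompl]
  rfl

lemma mem_map_of_mul_mem {J : Ideal A} {f : A} (hf : ∀ x, f * x ∈ J → x ∈ J)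
    (x : Localization.AtPrime m)
    (hx : algebraMap A _ f * x ∈ J.map (algebraMap A (Localization.AtPrime m))) :
    x ∈ J.map (algebraMap A (Localization.AtPrime m)) := by
  obtain ⟨a, s, rfl⟩ := IsLocalization.exists_mk'_eq m.primeCompl x
  rw [IsLocalization.mul_mk'_eq_mk'_of_mul, mk'_mem_map_iff] at hx
  obtain ⟨t, ht, h⟩ := hx
  rw [mk'_mem_map_iff]
  exact ⟨t, ht, hf _ (by rwa [mul_left_comm])⟩

/-- A ring with a regular sequence `f, g, h` generating an ideal primary to a maximal ideal `m`
is not Gorenstein if the socle modulo `(f, g, h)` contains two independent elements. -/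
lemma not_isGorensteinRing_of_socle {f g h : A} (hf : ∀ x, f * x = 0 → x = 0)
    (hg : ∀ x, g * x ∈ Ideal.span {f} → x ∈ Ideal.span {f})
    (hh : ∀ x, h * x ∈ Ideal.span {f} ⊔ Ideal.span {g} → x ∈ Ideal.span {f} ⊔ Ideal.span {g})
    {N : ℕ} (hN : m ^ N ≤ Ideal.span {f} ⊔ Ideal.span {g} ⊔ Ideal.span {h}) {s t : A}
    (hst : ∀ a b, a * s + b * t ∈ Ideal.span {f} ⊔ Ideal.span {g} ⊔ Ideal.span {h} ↔
      a ∈ m ∧ b ∈ m) : ¬ IsGorensteinRing A := by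
  rintro ⟨hA, hG⟩
  obtain ⟨n, hn⟩ := (hasFiniteInjectiveDimension_iff _).1 (hG m)
  let R := Localization.AtPrime m
  let φ : A →+* R := algebraMap A R
  have hφ (x : A) : (Ideal.span {x}).map φ = Ideal.span {φ x} := by
    rw [Ideal.map_span, Set.image_singleton]
  have h1 : HasInjectiveDimensionLE (ModuleCat.of (R ⧸ Ideal.span {φ f}) (R ⧸ Ideal.span {φ f}))
      n := by
    refine hasInjectiveDimensionLE_of_ker_eq_span (f := φ f) Ideal.Quotient.mk_surjective
      Ideal.mk_ker ?_ n hn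
    intro x hx
    have := mem_map_of_mul_mem m (J := ⊥) (f := f) (by simpa using hf) x (by
      rw [Ideal.map_bot]; exact hx)
    rwa [Ideal.map_bot] at this
  have h2 := hasInjectiveDimensionLE_quotient_sup _ (φ g) (fun x hx => by
    rw [← hφ] at hx ⊢
    exact mem_map_of_mul_mem m hg x hx) n h1
  have h3 := hasInjectiveDimensionLE_quotient_sup _ (φ h) (fun x hx => by
    rw [← hφ, ← hφ, ← Ideal.map_sup] at hx ⊢
    exact mem_map_of_mul_mem m hh x hx) n h2
  rw [← hφ, ← hφ, ← hφ, ← Ideal.map_sup, ← Ideal.map_sup] at h3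
  generalize Ideal.span {f} ⊔ Ideal.span {g} ⊔ Ideal.span {h} = J at hN hst h3
  have hJm : J ≤ m := fun x hx =>
    ((hst x 0).1 (by rw [zero_mul, add_zero]; exact J.mul_mem_right _ hx)).1
  let q := Ideal.Quotient.mk (J.map φ)
  have hle : J.map φ ≤ m.map φ := Ideal.map_mono hJm
  have hmR : m.map φ = IsLocalRing.maximalIdeal R := IsLocalization.AtPrime.map_eq_maximalIdeal m R
  have hq (x : R) : q x ∈ (m.map φ).map q ↔ x ∈ m.map φ := by
    rw [← Ideal.mem_comap, Ideal.comap_map_of_surjective _ Ideal.Quotient.mk_surjective,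
      ← RingHom.ker_eq_comap_bot, Ideal.mk_ker, sup_eq_left.2 hle]
  have hmax : ((m.map φ).map q).IsMaximal := by
    have : (m.map φ).IsMaximal := hmR ▸ inferInstance
    refine (Ideal.map_eq_top_or_isMaximal_of_surjective q Ideal.Quotient.mk_surjective
      this).resolve_left fun htop => this.ne_top ?_
    rw [Ideal.eq_top_iff_one, ← hq, htop]
    trivial
  refine not_hasInjectiveDimensionLE_of_socle (N := N) hmax ?_ (s := q (φ s)) (t := q (φ t)) ?_ n h3
  · rw [← Ideal.map_pow, ← Ideal.map_pow, eq_bot_iff]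
    refine (Ideal.map_mono (Ideal.map_mono hN)).trans ?_
    rw [Ideal.map_quotient_self]
  · intro a b
    obtain ⟨a, rfl⟩ := Ideal.Quotient.mk_surjective a
    obtain ⟨b, rfl⟩ := Ideal.Quotient.mk_surjective b
    obtain ⟨a, u, rfl⟩ := IsLocalization.exists_mk'_eq m.primeCompl a
    obtain ⟨b, v, rfl⟩ := IsLocalization.exists_mk'_eq m.primeCompl b
    have e : IsLocalization.mk' R a u * φ s + IsLocalization.mk' R b v * φ t =
        IsLocalization.mk' R (a * v * s + b * u * t) (u * v) := by
      rw [mul_comm _ (φ s), mul_comm _ (φ t), IsLocalization.mul_mk'_eq_mk'_of_mul,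
        IsLocalization.mul_mk'_eq_mk'_of_mul, ← IsLocalization.mk'_add]
      congr 1
      ring
    rw [hq, hq, ← _root_.map_mul q, ← _root_.map_mul q, ← _root_.map_add q, e,
      Ideal.Quotient.eq_zero_iff_mem, hmR, IsLocalization.AtPrime.mk'_mem_maximal_iff R m,
      IsLocalization.AtPrime.mk'_mem_maximal_iff R m, mk'_mem_map_iff]
    have hmp := hm.isPrime
    constructor
    · rintro ⟨c, hc, hca⟩
      have := (hst (c * (a * v)) (c * (b * u))).1 (by convert hca using 1; ring)
      exact ⟨(hmp.mem_or_mem ((hmp.mem_or_mem this.1).resolve_left hc)).resolve_right v.2,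
        (hmp.mem_or_mem ((hmp.mem_or_mem this.2).resolve_left hc)).resolve_right u.2⟩
    · rintro ⟨ha, hb⟩
      exact ⟨1, hmp.one_notMem, by
        rw [one_mul, hst]
        exact ⟨m.mul_mem_right _ ha, m.mul_mem_right _ hb⟩⟩

end Criterion

/-! ### Monomial subalgebras of a polynomial ring in three variables -/

/-- The exponent `e` has weight zero for the grading of `F[x, y, z]` by `ℤ/m` with weights
`-2`, `2`, `d`. -/
def WeightZero (m d : ℕ) (e : Fin 3 →₀ ℕ) : Prop :=
  2 * e 1 + d * e 2 ≡ 2 * e 0 [MOD m]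

theorem WeightZero.add_iff {m d : ℕ} {a b : Fin 3 →₀ ℕ} (ha : WeightZero m d a) :
    WeightZero m d (a + b) ↔ WeightZero m d b := by
  unfold WeightZero at *
  have h1 : 2 * (a + b) 1 + d * (a + b) 2 = (2 * a 1 + d * a 2) + (2 * b 1 + d * b 2) := by
    simp only [Finsupp.coe_add, Pi.add_apply]; ring
  have h2 : 2 * (a + b) 0 = 2 * a 0 + 2 * b 0 := by
    simp only [Finsupp.coe_add, Pi.add_apply]; ring
  rw [h1, h2]
  exact ⟨fun h => Nat.ModEq.add_left_cancel ha h, fun h => Nat.ModEq.add ha h⟩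

theorem weightZero_single (m d : ℕ) (i : Fin 3) : WeightZero m d (Finsupp.single i m) := by
  unfold WeightZero
  fin_cases i <;> simp [Nat.ModEq]

section
variable {F : Type u} [Field F] {A : Type u} [CommRing A] [Algebra F A]
  {m d : ℕ} {ι : A →ₐ[F] MvPolynomial (Fin 3) F}

theorem mem_span_image_iff_of_weightZero (hι : Function.Injective ι)
    (hr : ∀ q, q ∈ ι.range ↔ ∀ e ∈ q.support, WeightZero m d e)
    {f : Fin 3 → A} (hf : ∀ i, ι (f i) = MvPolynomial.X i ^ m) (s : Set (Fin 3)) (a : A) :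
    a ∈ Ideal.span (f '' s) ↔ ∀ e ∈ (ι a).support, ∃ i ∈ s, m ≤ e i := by
  constructor
  · intro h
    have h1 := Ideal.mem_map_of_mem ι h
    have h2 : ι '' (f '' s) = (fun e => monomial e (1 : F)) ''
        ((fun i => Finsupp.single i m) '' s) := by
      rw [Set.image_image, Set.image_image]
      refine Set.image_congr fun i _ => ?_
      rw [hf, MvPolynomial.X_pow_eq_monomial]
    rw [Ideal.map_span, h2, MvPolynomial.mem_ideal_span_monomial_image] at h1
    intro e he
    obtain ⟨_, ⟨i, hi, rfl⟩, hle⟩ := h1 e he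
    exact ⟨i, hi, by simpa using hle i⟩
  · intro h
    have key : ∀ e ∈ (ι a).support, ∃ b ∈ Ideal.span (f '' s),
        ι b = monomial e ((ι a).coeff e) := by
      intro e he
      obtain ⟨i, hi, hm⟩ := h e he
      have hw : WeightZero m d e := (hr (ι a)).1 ⟨a, rfl⟩ e he
      have hadd : Finsupp.single i m + (e - Finsupp.single i m) = e :=
        add_tsub_cancel_of_le (by simpa using hm)
      have hw' : WeightZero m d (e - Finsupp.single i m) := by
        rw [← (weightZero_single m d i).add_iff, hadd]; exact hw
      obtain ⟨c, hc⟩ := (hr (monomial (e - Finsupp.single i m) ((ι a).coeff e))).2 (by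
        intro e' he'
        rw [Finset.mem_singleton.1 (support_monomial_subset he')]
        exact hw')
      refine ⟨f i * c, Ideal.mul_mem_right _ _ (Ideal.subset_span ⟨i, hi, rfl⟩), ?_⟩
      have hc' : ι c = monomial (e - Finsupp.single i m) ((ι a).coeff e) := hc
      rw [_root_.map_mul, hf, hc', MvPolynomial.X_pow_eq_monomial, monomial_mul, hadd, one_mul]
    choose! b hb hbι using key
    have : a = ∑ e ∈ (ι a).support, b e := by
      apply hι
      rw [map_sum]
      conv_lhs => rw [(ι a).as_sum]
      exact Finset.sum_congr rfl fun e he => (hbι e he).symm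
    rw [this]
    exact Ideal.sum_mem _ hb

theorem mem_span_image_of_mul_mem_of_weightZero (hι : Function.Injective ι)
    (hr : ∀ q, q ∈ ι.range ↔ ∀ e ∈ q.support, WeightZero m d e)
    {f : Fin 3 → A} (hf : ∀ i, ι (f i) = MvPolynomial.X i ^ m) {s : Set (Fin 3)} {j : Fin 3}
    (hj : j ∉ s) (x : A) (hx : f j * x ∈ Ideal.span (f '' s)) : x ∈ Ideal.span (f '' s) := by
  rw [mem_span_image_iff_of_weightZero hι hr hf] at hx ⊢
  intro e he
  obtain ⟨i, hi, hle⟩ := hx (Finsupp.single j m + e) (by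
    rw [mem_support_iff, _root_.map_mul, hf, MvPolynomial.X_pow_eq_monomial, coeff_monomial_mul,
      one_mul]
    exact mem_support_iff.1 he)
  refine ⟨i, hi, ?_⟩
  have hij : j ≠ i := fun h => hj (h ▸ hi)
  simpa [Finsupp.single_apply, hij] using hle

end

theorem exists_socle_exponents {m d : ℕ} (hm : Odd m) (hd : ¬ m ∣ d) :
    ∃ E E' : Fin 3 →₀ ℕ, E ≠ E' ∧ WeightZero m d E ∧ WeightZero m d E' ∧
      (∀ i, E i < m) ∧ (∀ i, E' i < m) ∧
      (∀ e, WeightZero m d e → e ≠ 0 → ∃ i, m ≤ (E + e) i) ∧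
      (∀ e, WeightZero m d e → e ≠ 0 → ∃ i, m ≤ (E' + e) i) := by
  obtain ⟨r, hr⟩ := hm
  have hm0 : 0 < m := by omega
  obtain ⟨k, hkm, hk, hmax⟩ : ∃ k, k < m ∧ m ∣ d * k ∧ ∀ l, l < m → m ∣ d * l → l ≤ k := by
    classical
    refine ⟨Nat.findGreatest (fun k => m ∣ d * k) (m - 1), ?_, ?_, ?_⟩
    · have := Nat.findGreatest_le (P := fun k => m ∣ d * k) (m - 1)
      omega
    · exact Nat.findGreatest_spec (P := fun k => m ∣ d * k) (Nat.zero_le _) (by simp)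
    · intro l hl hdl
      exact Nat.le_findGreatest (P := fun k => m ∣ d * k) (by omega) hdl
  obtain ⟨j, hjm, hj⟩ : ∃ j, j < m ∧ 2 * j ≡ d [MOD m] := by
    refine ⟨d * (r + 1) % m, Nat.mod_lt _ hm0, ?_⟩
    calc 2 * (d * (r + 1) % m) ≡ 2 * (d * (r + 1)) [MOD m] := (Nat.mod_modEq _ _).mul_left 2
      _ = d + m * d := by rw [hr]; ring
      _ ≡ d [MOD m] := by simp [Nat.ModEq]
  have hdm : d * (m - 1) + d = m * d := by
    conv_lhs => rw [← Nat.mul_succ, Nat.succ_eq_add_one, Nat.sub_add_cancel hm0]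
    ring
  refine ⟨Finsupp.equivFunOnFinite.symm ![m - 1, m - 1, k],
    Finsupp.equivFunOnFinite.symm ![m - 1 - j, m - 1, m - 1], ?_, ?_, ?_, ?_, ?_, ?_, ?_⟩
  · intro h
    have h2 := DFunLike.congr_fun h 2
    simp at h2
    rw [h2] at hk
    exact hd ((Nat.dvd_add_right hk).1 (hdm ▸ Dvd.intro _ rfl))
  · simp only [WeightZero, Finsupp.equivFunOnFinite_symm_apply_apply]
    change 2 * (m - 1) + d * k ≡ 2 * (m - 1) [MOD m]
    obtain ⟨c, hc⟩ := hk
    simp [hc, Nat.ModEq]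
  · simp only [WeightZero, Finsupp.equivFunOnFinite_symm_apply_apply]
    change 2 * (m - 1) + d * (m - 1) ≡ 2 * (m - 1 - j) [MOD m]
    refine Nat.ModEq.add_right_cancel hj.symm ?_
    have h1 : 2 * (m - 1 - j) + 2 * j = 2 * (m - 1) := by omega
    rw [add_assoc, hdm, h1]
    simp [Nat.ModEq]
  · intro i
    fin_cases i <;> simp <;> omega
  · intro i
    fin_cases i <;> simp <;> omega
  · intro e he hne
    by_contra! hlt
    have h0 := hlt 0
    have h1 := hlt 1
    have h2 := hlt 2
    simp at h0 h1 h2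
    have e0 : e 0 = 0 := by omega
    have e1 : e 1 = 0 := by omega
    rw [WeightZero, e0, e1] at he
    simp only [mul_zero, zero_add] at he
    have := hmax (k + e 2) h2 (by
      rw [mul_add]; exact dvd_add hk ((Nat.modEq_zero_iff_dvd).1 he))
    apply hne
    ext i
    fin_cases i
    · exact e0
    · exact e1
    · simp; omega
  · intro e he hne
    by_contra! hlt
    have h0 := hlt 0
    have h1 := hlt 1
    have h2 := hlt 2
    simp at h0 h1 h2
    have e2 : e 2 = 0 := by omega
    have e1 : e 1 = 0 := by omega
    rw [WeightZero, e2, e1] at he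
    simp only [mul_zero, add_zero] at he
    have h3 : m ∣ 2 * e 0 := (Nat.modEq_zero_iff_dvd).1 he.symm
    have h4 : m ∣ e 0 := Nat.Coprime.dvd_of_dvd_mul_left (by
      rw [Nat.coprime_comm, Nat.coprime_two_left]; exact ⟨r, hr⟩) h3
    have h5 := Nat.eq_zero_of_dvd_of_lt h4 (by omega)
    apply hne
    ext i
    fin_cases i
    · exact h5
    · exact e1
    · exact e2

section
variable {F : Type u} [Field F] {A : Type u} [CommRing A] [Algebra F A]
  {m d : ℕ} {ι : A →ₐ[F] MvPolynomial (Fin 3) F}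

theorem not_isGorensteinRing_of_weightZero (hι : Function.Injective ι)
    (hr : ∀ q, q ∈ ι.range ↔ ∀ e ∈ q.support, WeightZero m d e)
    (hm : Odd m) (hd : ¬ m ∣ d) : ¬ IsGorensteinRing A := by
  have hmon : ∀ e, WeightZero m d e → ∃ a, ι a = monomial e 1 := by
    intro e he
    refine (hr _).2 fun e' he' => ?_
    rw [Finset.mem_singleton.1 (support_monomial_subset he')]
    exact he
  have hf : ∀ i, ∃ a, ι a = MvPolynomial.X i ^ m := by
    intro i
    rw [MvPolynomial.X_pow_eq_monomial]
    exact hmon _ (weightZero_single m d i)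
  choose f hf using hf
  have hm0 : 0 < m := hm.pos
  obtain ⟨E, E', hne, hE, hE', hlt, hlt', hsoc, hsoc'⟩ := exists_socle_exponents hm hd
  obtain ⟨s, hs⟩ := hmon E hE
  obtain ⟨t, ht⟩ := hmon E' hE'
  let ε : A →+* F := (constantCoeff (σ := Fin 3) (R := F)).comp ι.toRingHom
  have hε : ∀ a, ε a = (ι a).coeff 0 := fun a => rfl
  have hsurj : Function.Surjective ε := fun c => ⟨algebraMap F A c, by
    rw [hε, AlgHom.commutes]; simp⟩
  have := RingHom.ker_isMaximal_of_surjective ε hsurj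
  have h2 : (Ideal.span {f 0} ⊔ Ideal.span {f 1}) = Ideal.span (f '' {0, 1}) := by
    rw [← Ideal.span_union, Set.image_pair]; rfl
  have h3 : (Ideal.span {f 0} ⊔ Ideal.span {f 1} ⊔ Ideal.span {f 2}) =
      Ideal.span (f '' Set.univ) := by
    rw [h2, ← Ideal.span_union, ← Set.image_singleton (f := f), ← Set.image_union]
    congr 2
    ext i
    fin_cases i <;> simp
  have h1 : Ideal.span {f 0} = Ideal.span (f '' {0}) := by rw [Set.image_singleton]
  have hJ := fun a => (mem_span_image_iff_of_weightZero hι hr hf Set.univ a)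
  have hmem : ∀ (E : Fin 3 →₀ ℕ) (s a : A), ι s = monomial E 1 →
      (∀ e, WeightZero m d e → e ≠ 0 → ∃ i, m ≤ (E + e) i) → (ι a).coeff 0 = 0 →
      a * s ∈ Ideal.span (f '' Set.univ) := by
    intro E s a hs hsoc ha
    rw [hJ]
    intro e he
    rw [mem_support_iff, _root_.map_mul, hs, coeff_mul_monomial'] at he
    split_ifs at he with hle
    · rw [mul_one] at he
      obtain ⟨i, hi⟩ := hsoc (e - E) ((hr (ι a)).1 ⟨a, rfl⟩ _ (mem_support_iff.2 he)) (by
        rintro h0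
        rw [h0] at he
        exact he ha)
      rw [add_tsub_cancel_of_le hle] at hi
      exact ⟨i, trivial, hi⟩
    · exact absurd rfl he
  have hmem' : ∀ (E E' : Fin 3 →₀ ℕ) (s t a b : A), ι s = monomial E 1 → ι t = monomial E' 1 →
      E ≠ E' → (∀ i, E i < m) →
      (∀ e, WeightZero m d e → e ≠ 0 → ∃ i, m ≤ (E' + e) i) →
      a * s + b * t ∈ Ideal.span (f '' Set.univ) → (ι a).coeff 0 = 0 := by
    intro E E' s t a b hs ht hne hlt hsoc' h
    rw [hJ] at h
    have h0 : (ι b * ι t).coeff E = 0 := by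
      rw [ht, coeff_mul_monomial', mul_one]
      split_ifs with hle
      · by_contra hb
        obtain ⟨i, hi⟩ := hsoc' (E - E') ((hr (ι b)).1 ⟨b, rfl⟩ _ (mem_support_iff.2 hb))
          (fun h0 => hne (le_antisymm (tsub_eq_zero_iff_le.1 h0) hle))
        rw [add_tsub_cancel_of_le hle] at hi
        exact absurd (hlt i) (not_lt.2 hi)
      · rfl
    by_contra ha
    obtain ⟨i, -, hi⟩ := h E (by
      rw [mem_support_iff, _root_.map_add, _root_.map_mul, _root_.map_mul, coeff_add, h0, hs,
        coeff_mul_monomial']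
      simpa using ha)
    exact absurd (hlt i) (not_lt.2 hi)
  refine not_isGorensteinRing_of_socle (RingHom.ker ε) (f := f 0) (g := f 1) (h := f 2)
    ?_ ?_ ?_ (N := 3 * m) ?_ (s := s) (t := t) ?_
  · intro x hx
    have h4 := congrArg ι hx
    rw [_root_.map_mul, hf, _root_.map_zero] at h4
    apply hι
    rw [_root_.map_zero]
    exact (mul_eq_zero.1 h4).resolve_left (pow_ne_zero _ (MvPolynomial.X_ne_zero _))
  · intro x hx
    rw [h1] at hx ⊢
    exact mem_span_image_of_mul_mem_of_weightZero hι hr hf (by simp) x hx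
  · intro x hx
    rw [h2] at hx ⊢
    exact mem_span_image_of_mul_mem_of_weightZero hι hr hf (by simp) x hx
  · rw [h3]
    intro x hx
    rw [hJ]
    have h4 : ι x ∈ (idealOfVars (Fin 3) F) ^ (3 * m) := by
      have h5 := Ideal.mem_map_of_mem ι hx
      rw [Ideal.map_pow] at h5
      refine Ideal.pow_right_mono ?_ _ h5
      rw [Ideal.map_le_iff_le_comap]
      intro y hy
      rw [Ideal.mem_comap, ← pow_one (idealOfVars (Fin 3) F), mem_pow_idealOfVars_iff]
      intro e he
      by_contra hlt
      have h6 : e = 0 := by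
        ext i
        have := Finsupp.le_degree i e
        simp; omega
      subst h6
      exact mem_support_iff.1 he hy
    rw [mem_pow_idealOfVars_iff] at h4
    intro e he
    have h5 := h4 e he
    by_contra! hlt
    have h6 : e.degree = e 0 + e 1 + e 2 := by
      rw [Finsupp.degree_eq_sum, Fin.sum_univ_three]
    have := hlt 0 trivial
    have := hlt 1 trivial
    have := hlt 2 trivial
    omega
  · intro a b
    rw [h3, RingHom.mem_ker, RingHom.mem_ker, hε, hε]
    constructor
    · intro h
      exact ⟨hmem' E E' s t a b hs ht hne hlt hsoc' h,
        hmem' E' E t s b a ht hs hne.symm hlt' hsoc (by rwa [add_comm])⟩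
    · rintro ⟨ha, hb⟩
      exact Ideal.add_mem _ (hmem E s a hs hsoc ha) (hmem E' t b ht hsoc' hb)

end

/-- The exponent of `(x ^ m) ^ e₀ (y ^ m) ^ e₁ z ^ e₂ (x y) ^ r`. -/
def expandExponent (m r : ℕ) (e : Fin 3 →₀ ℕ) : Fin 3 →₀ ℕ :=
  Finsupp.equivFunOnFinite.symm ![m * e 0 + r, m * e 1 + r, e 2]

theorem expandExponent_eq_iff {m r r' : ℕ} (hr : r < m) (hr' : r' < m) (e e' : Fin 3 →₀ ℕ) :
    expandExponent m r e = expandExponent m r' e' ↔ r = r' ∧ e = e' := by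
  constructor
  · intro h
    have h0 := DFunLike.congr_fun h 0
    have h1 := DFunLike.congr_fun h 1
    have h2 := DFunLike.congr_fun h 2
    simp [expandExponent] at h0 h1 h2
    have hrr : r = r' := by
      have := congrArg (· % m) h0
      simpa [Nat.add_mod, Nat.mod_eq_of_lt hr, Nat.mod_eq_of_lt hr'] using this
    subst hrr
    have hm : 0 < m := by omega
    refine ⟨rfl, ?_⟩
    ext i
    fin_cases i
    · exact Nat.eq_of_mul_eq_mul_left hm (by simpa using h0)
    · exact Nat.eq_of_mul_eq_mul_left hm (by simpa using h1)
    · exact h2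
  · rintro ⟨rfl, rfl⟩
    rfl

section
variable {F : Type u} [Field F]

theorem aeval_monomial_mul_pow (m r : ℕ) (e : Fin 3 →₀ ℕ) (c : F) :
    aeval (![MvPolynomial.X 0 ^ m, MvPolynomial.X 1 ^ m, MvPolynomial.X 2] :
      Fin 3 → MvPolynomial (Fin 3) F) (monomial e c) *
        (MvPolynomial.X 0 * MvPolynomial.X 1) ^ r = monomial (expandExponent m r e) c := by
  rw [aeval_monomial, monomial_eq, Finsupp.prod_fintype _ _ (by simp),
    Finsupp.prod_fintype _ _ (by simp), Fin.prod_univ_three, Fin.prod_univ_three]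
  simp [expandExponent, MvPolynomial.algebraMap_eq]
  ring

theorem coeff_aeval_mul_pow {m r r' : ℕ} (hr : r < m) (hr' : r' < m)
    (p : MvPolynomial (Fin 3) F) (e : Fin 3 →₀ ℕ) :
    coeff (expandExponent m r e) (aeval (![MvPolynomial.X 0 ^ m, MvPolynomial.X 1 ^ m,
      MvPolynomial.X 2] : Fin 3 → MvPolynomial (Fin 3) F) p *
        (MvPolynomial.X 0 * MvPolynomial.X 1) ^ r') = if r' = r then coeff e p else 0 := by
  induction p using MvPolynomial.induction_on' with
  | monomial e' c =>
    rw [aeval_monomial_mul_pow, coeff_monomial, coeff_monomial]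
    simp only [expandExponent_eq_iff hr' hr]
    split_ifs <;> simp_all
  | add p q hp hq =>
    rw [_root_.map_add, add_mul, coeff_add, hp, hq]
    split_ifs <;> simp

variable {A : Type u} [CommRing A] [Algebra F A]
  {m d : ℕ} {ι : A →ₐ[F] MvPolynomial (Fin 3) F}

theorem isGorensteinRing_of_weightZero (hι : Function.Injective ι)
    (hr : ∀ q, q ∈ ι.range ↔ ∀ e ∈ q.support, WeightZero m d e)
    (hm : Odd m) (hd : m ∣ d) : IsGorensteinRing A := by
  have hw : ∀ e, WeightZero m d e ↔ e 0 ≡ e 1 [MOD m] := by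
    intro e
    have h1 : d * e 2 ≡ 0 [MOD m] := (Nat.modEq_zero_iff_dvd).2 (hd.mul_right _)
    have h2 : Nat.gcd m 2 = 1 := Nat.coprime_two_right.2 hm
    constructor
    · intro h
      refine Nat.ModEq.cancel_left_of_coprime h2 ?_
      have h3 := (Nat.ModEq.add_left (2 * e 1) h1).symm.trans h
      simpa using h3.symm
    · intro h
      have h3 := (Nat.ModEq.add_left (2 * e 1) h1)
      rw [add_zero] at h3
      exact h3.trans (h.symm.mul_left 2)
  have hmon : ∀ e (c : F), WeightZero m d e → ∃ a, ι a = monomial e c := by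
    intro e c he
    refine (hr _).2 fun e' he' => ?_
    rw [Finset.mem_singleton.1 (support_monomial_subset he')]
    exact he
  have hpow : ∀ i, ∃ a, ι a = MvPolynomial.X i ^ m := by
    intro i
    rw [MvPolynomial.X_pow_eq_monomial]
    exact hmon _ _ (weightZero_single m d i)
  obtain ⟨a₀, h₀⟩ := hpow 0
  obtain ⟨a₁, h₁⟩ := hpow 1
  obtain ⟨a₂, h₂⟩ : ∃ a, ι a = MvPolynomial.X 2 := by
    rw [MvPolynomial.X]
    exact hmon _ _ ((hw _).2 (by simp [Nat.ModEq]))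
  obtain ⟨w, hwι⟩ : ∃ a, ι a = MvPolynomial.X 0 * MvPolynomial.X 1 := by
    rw [MvPolynomial.X, MvPolynomial.X, monomial_mul]
    exact hmon _ _ ((hw _).2 (by simp [Nat.ModEq]))
  obtain ⟨k, rfl⟩ : ∃ k, m = k + 1 := ⟨m - 1, by have := hm.pos; omega⟩
  let φ : MvPolynomial (Fin 3) F →ₐ[F] A := aeval ![a₀, a₁, a₂]
  have hφ : ∀ p, ι (φ p) = aeval (![MvPolynomial.X 0 ^ (k + 1), MvPolynomial.X 1 ^ (k + 1),
      MvPolynomial.X 2] : Fin 3 → MvPolynomial (Fin 3) F) p := by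
    intro p
    rw [← AlgHom.comp_apply]
    congr 1
    ext i : 1
    fin_cases i <;> simp [φ, h₀, h₁, h₂]
  let _ : Algebra (MvPolynomial (Fin 3) F) A := φ.toRingHom.toAlgebra
  have halg : ∀ p, algebraMap (MvPolynomial (Fin 3) F) A p = φ p := fun p => rfl
  let v : Fin (k + 1) → A := fun i => w ^ (i : ℕ)
  have hli : LinearIndependent (MvPolynomial (Fin 3) F) v := by
    rw [Fintype.linearIndependent_iff]
    intro g hg i
    have h := congrArg ι hg
    rw [map_sum, _root_.map_zero] at h
    ext e
    have h' := congrArg (coeff (expandExponent (k + 1) i e)) h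
    rw [coeff_sum] at h'
    simp only [v, Algebra.smul_def, halg, _root_.map_mul, _root_.map_pow, hφ, hwι] at h'
    rw [Finset.sum_congr rfl (fun j _ => coeff_aeval_mul_pow i.2 j.2 (g j) e)] at h'
    simpa [Fin.val_inj] using h'
  have hsp : ⊤ ≤ Submodule.span (MvPolynomial (Fin 3) F) (Set.range v) := by
    rintro a -
    have key : ∀ e ∈ (ι a).support, ∃ b ∈ Submodule.span (MvPolynomial (Fin 3) F) (Set.range v),
        ι b = monomial e ((ι a).coeff e) := by
      intro e he
      have hmod := (hw e).1 ((hr (ι a)).1 ⟨a, rfl⟩ e he)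
      let e' : Fin 3 →₀ ℕ :=
        Finsupp.equivFunOnFinite.symm ![e 0 / (k + 1), e 1 / (k + 1), e 2]
      have hee : expandExponent (k + 1) (e 0 % (k + 1)) e' = e := by
        ext i
        fin_cases i
        · simp [expandExponent, e', Nat.div_add_mod]
        · have : e 0 % (k + 1) = e 1 % (k + 1) := hmod
          simp [expandExponent, e', Nat.div_add_mod, this]
        · simp [expandExponent, e']
      refine ⟨monomial e' ((ι a).coeff e) • v ⟨e 0 % (k + 1), Nat.mod_lt _ k.succ_pos⟩,
        Submodule.smul_mem _ _ (Submodule.subset_span ⟨_, rfl⟩), ?_⟩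
      rw [Algebra.smul_def, halg, _root_.map_mul, hφ]
      simp only [v, _root_.map_pow, hwι]
      rw [aeval_monomial_mul_pow, hee]
    choose! b hb hbι using key
    have : a = ∑ e ∈ (ι a).support, b e := by
      apply hι
      rw [map_sum]
      conv_lhs => rw [(ι a).as_sum]
      exact Finset.sum_congr rfl fun e he => (hbι e he).symm
    rw [this]
    exact Submodule.sum_mem _ hb
  refine isGorensteinRing_of_basis_pow (m := k) w (MvPolynomial.X 0 * MvPolynomial.X 1) ?_
    (Module.Basis.mk hli hsp) fun i => Module.Basis.mk_apply hli hsp i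
  apply hι
  rw [halg, hφ, _root_.map_pow, hwι]
  simp [mul_pow]

end

theorem isGorensteinRing_iff_dvd {F : Type u} [Field F] {A : Type u} [CommRing A] [Algebra F A]
    {m d : ℕ} {ι : A →ₐ[F] MvPolynomial (Fin 3) F} (hι : Function.Injective ι)
    (hr : ∀ q, q ∈ ι.range ↔ ∀ e ∈ q.support, WeightZero m d e) (hm : Odd m) :
    IsGorensteinRing A ↔ m ∣ d :=
  ⟨fun h => by_contra fun hd => not_isGorensteinRing_of_weightZero hι hr hm hd h,
    isGorensteinRing_of_weightZero hι hr hm⟩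

/-! ### Substitution actions and invariants -/

section
variable {F : Type u} [Field F]

theorem polyAct_X {m : ℕ} (M : Matrix (Fin m) (Fin m) F) (i : Fin m) :
    polyAct M (MvPolynomial.X i) = ∑ j, M i j • MvPolynomial.X j :=
  aeval_X _ _

theorem polyAct_mul {m : ℕ} (M N : Matrix (Fin m) (Fin m) F) :
    polyAct (M * N) = (polyAct N).comp (polyAct M) := by
  ext i : 1
  simp only [AlgHom.comp_apply, polyAct_X, map_sum, _root_.map_smul, Matrix.mul_apply,
    Finset.smul_sum, Finset.sum_smul, smul_smul]
  exact Finset.sum_comm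

theorem polyAct_mul_apply {m : ℕ} (M N : Matrix (Fin m) (Fin m) F)
    (p : MvPolynomial (Fin m) F) : polyAct (M * N) p = polyAct N (polyAct M p) := by
  rw [polyAct_mul, AlgHom.comp_apply]

theorem polyAct_one {m : ℕ} : polyAct (1 : Matrix (Fin m) (Fin m) F) = AlgHom.id F _ := by
  ext i : 1
  rw [polyAct_X]
  simp [Matrix.one_apply]

theorem polyAct_injective {m : ℕ} {M N : Matrix (Fin m) (Fin m) F} (h : M * N = 1) :
    Function.Injective (polyAct M) := by
  intro p q hpq
  have := congrArg (polyAct N) hpq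
  rwa [← polyAct_mul_apply, ← polyAct_mul_apply, h, polyAct_one] at this

/-- The matrices fixing a given polynomial. -/
def polyFixing {m : ℕ} (p : MvPolynomial (Fin m) F) :
    Submonoid (Matrix (Fin m) (Fin m) F) where
  carrier := {M | polyAct M p = p}
  mul_mem' := fun {M N} hM hN => by
    simp only [Set.mem_ofPred_eq] at *
    rw [polyAct_mul_apply, hM, hN]
  one_mem' := by simp [polyAct_one]

theorem mem_polyFixing {m : ℕ} {p : MvPolynomial (Fin m) F}
    {M : Matrix (Fin m) (Fin m) F} : M ∈ polyFixing p ↔ polyAct M p = p := Iff.rfl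

theorem polyAct_diagonal_monomial (v : Fin 3 → F) (e : Fin 3 →₀ ℕ) (c : F) :
    polyAct (diagonal v) (monomial e c) =
      monomial e (v 0 ^ e 0 * v 1 ^ e 1 * v 2 ^ e 2 * c) := by
  rw [polyAct, aeval_monomial, Finsupp.prod_fintype _ _ (by simp), monomial_eq,
    Finsupp.prod_fintype _ _ (by simp)]
  simp [Matrix.diagonal_apply, Fin.prod_univ_three, MvPolynomial.smul_eq_C_mul,
    MvPolynomial.algebraMap_eq]
  ring

theorem coeff_polyAct_diagonal (v : Fin 3 → F) (p : MvPolynomial (Fin 3) F) (e : Fin 3 →₀ ℕ) :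
    coeff e (polyAct (diagonal v) p) = v 0 ^ e 0 * v 1 ^ e 1 * v 2 ^ e 2 * coeff e p := by
  induction p using MvPolynomial.induction_on' with
  | monomial e' c =>
    rw [polyAct_diagonal_monomial, coeff_monomial, coeff_monomial]
    split_ifs with h
    · rw [h]
    · simp
  | add p q hp hq => rw [_root_.map_add, coeff_add, hp, hq, coeff_add, mul_add]

theorem polyAct_diagonal_eq_iff (v : Fin 3 → F) (p : MvPolynomial (Fin 3) F) :
    polyAct (diagonal v) p = p ↔
      ∀ e ∈ p.support, v 0 ^ e 0 * v 1 ^ e 1 * v 2 ^ e 2 = 1 := by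
  rw [MvPolynomial.ext_iff]
  refine forall_congr' fun e => ?_
  rw [coeff_polyAct_diagonal, mem_support_iff]
  constructor
  · intro h h0
    exact mul_right_cancel₀ h0 (by rw [h, one_mul])
  · intro h
    by_cases h0 : coeff e p = 0
    · rw [h0, mul_zero]
    · rw [h h0, one_mul]

/-- The permutation matrix exchanging the last two coordinates. -/
def swapMat (F : Type u) [Field F] : Matrix (Fin 3) (Fin 3) F :=
  !![1, 0, 0; 0, 0, 1; 0, 1, 0]

/-- Exchange the last two exponents. -/
def swapExponent (e : Fin 3 →₀ ℕ) : Fin 3 →₀ ℕ :=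
  Finsupp.equivFunOnFinite.symm ![e 0, e 2, e 1]

theorem swapExponent_swapExponent (e : Fin 3 →₀ ℕ) : swapExponent (swapExponent e) = e := by
  ext i
  fin_cases i <;> simp [swapExponent]

theorem polyAct_swapMat_monomial (e : Fin 3 →₀ ℕ) (c : F) :
    polyAct (swapMat F) (monomial e c) = monomial (swapExponent e) c := by
  rw [polyAct, aeval_monomial, Finsupp.prod_fintype _ _ (by simp), monomial_eq,
    Finsupp.prod_fintype _ _ (by simp)]
  simp [swapMat, swapExponent, Fin.prod_univ_three, Fin.sum_univ_three,
    MvPolynomial.algebraMap_eq, -mul_eq_mul_left_iff]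
  ring

theorem coeff_polyAct_swapMat (p : MvPolynomial (Fin 3) F) (e : Fin 3 →₀ ℕ) :
    coeff (swapExponent e) (polyAct (swapMat F) p) = coeff e p := by
  induction p using MvPolynomial.induction_on' with
  | monomial e' c =>
    rw [polyAct_swapMat_monomial, coeff_monomial, coeff_monomial]
    have h : swapExponent e' = swapExponent e ↔ e' = e :=
      (Function.Involutive.injective swapExponent_swapExponent).eq_iff
    simp only [h]
  | add p q hp hq => rw [_root_.map_add, coeff_add, hp, hq, coeff_add]

end

/-! ### Dihedral invariants -/

/-- The substitution `x ↦ x`, `y ↦ y z`, `z ↦ y ^ d + z ^ d`. -/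
def dihedralMap (F : Type u) [Field F] (d : ℕ) :
    MvPolynomial (Fin 3) F →ₐ[F] MvPolynomial (Fin 3) F :=
  aeval ![MvPolynomial.X 0, MvPolynomial.X 1 * MvPolynomial.X 2,
    MvPolynomial.X 1 ^ d + MvPolynomial.X 2 ^ d]

section
variable {F : Type u} [Field F]

@[simp] theorem dihedralMap_X_zero (d : ℕ) :
    dihedralMap F d (MvPolynomial.X 0) = MvPolynomial.X 0 := by simp [dihedralMap]

@[simp] theorem dihedralMap_X_one (d : ℕ) :
    dihedralMap F d (MvPolynomial.X 1) = MvPolynomial.X 1 * MvPolynomial.X 2 := by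
  simp [dihedralMap]

@[simp] theorem dihedralMap_X_two (d : ℕ) :
    dihedralMap F d (MvPolynomial.X 2) = MvPolynomial.X 1 ^ d + MvPolynomial.X 2 ^ d := by
  simp [dihedralMap]

theorem coeff_add_pow_of_apply_eq_zero {d : ℕ} (hd : 0 < d) (n : ℕ) (e : Fin 3 →₀ ℕ)
    (he : e 2 = 0) :
    coeff e ((MvPolynomial.X 1 ^ d + MvPolynomial.X 2 ^ d : MvPolynomial (Fin 3) F) ^ n) =
      if Finsupp.single 1 (d * n) = e then 1 else 0 := by
  obtain ⟨r, hr⟩ := sub_dvd_pow_sub_pow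
    (MvPolynomial.X 1 ^ d + MvPolynomial.X 2 ^ d : MvPolynomial (Fin 3) F)
    (MvPolynomial.X 1 ^ d) n
  rw [add_sub_cancel_left, sub_eq_iff_eq_add] at hr
  rw [hr, coeff_add, ← pow_mul, MvPolynomial.X_pow_eq_monomial, MvPolynomial.X_pow_eq_monomial,
    coeff_monomial_mul', coeff_monomial, if_neg, zero_add]
  intro h
  have := h 2
  rw [he] at this
  simp at this
  omega

theorem coeff_dihedralMap_monomial {d : ℕ} (hd : 0 < d) (e e' : Fin 3 →₀ ℕ) (c : F)
    (h : e 1 ≤ e' 1) :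
    coeff (Finsupp.equivFunOnFinite.symm ![e 0, e 1 + d * e 2, e 1])
      (dihedralMap F d (monomial e' c)) = if e' = e then c else 0 := by
  have h1 : dihedralMap F d (monomial e' c) =
      monomial (Finsupp.equivFunOnFinite.symm ![e' 0, e' 1, e' 1]) c *
        (MvPolynomial.X 1 ^ d + MvPolynomial.X 2 ^ d) ^ e' 2 := by
    rw [dihedralMap, aeval_monomial, Finsupp.prod_fintype _ _ (by simp), monomial_eq,
      Finsupp.prod_fintype _ _ (by simp), Fin.prod_univ_three, Fin.prod_univ_three]
    simp [MvPolynomial.algebraMap_eq]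
    ring
  rw [h1, coeff_monomial_mul']
  split_ifs with hle heq heq
  · subst heq
    rw [coeff_add_pow_of_apply_eq_zero hd _ _ (by simp), if_pos, mul_one]
    ext i
    fin_cases i <;> simp
  · have h0 := hle 0
    have h2 := hle 2
    simp at h0 h2
    rw [coeff_add_pow_of_apply_eq_zero hd _ _ (by simp; omega), if_neg, mul_zero]
    intro hs
    have hs0 := DFunLike.congr_fun hs 0
    have hs1 := DFunLike.congr_fun hs 1
    simp at hs0 hs1
    apply heq
    ext i
    fin_cases i
    · simp; omega
    · simp; omega
    · refine Nat.eq_of_mul_eq_mul_left hd ?_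
      change d * e' 2 = d * e 2
      omega
  · exfalso
    subst heq
    apply hle
    intro i
    fin_cases i <;> simp
  · rfl

theorem dihedralMap_injective {d : ℕ} (hd : 0 < d) : Function.Injective (dihedralMap F d) := by
  rw [injective_iff_map_eq_zero]
  intro q hq
  by_contra hne
  obtain ⟨e, he, hmin⟩ := q.support.exists_min_image (fun e => e 1)
    (Finset.nonempty_iff_ne_empty.2 fun h => hne (MvPolynomial.support_eq_empty.1 h))
  have h := congrArg (coeff (Finsupp.equivFunOnFinite.symm ![e 0, e 1 + d * e 2, e 1])) hq
  rw [q.as_sum, map_sum, coeff_sum,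
    Finset.sum_congr rfl (fun e' he' => coeff_dihedralMap_monomial hd e e' _ (hmin e' he'))] at h
  simp at h
  exact mem_support_iff.1 he h

theorem pow_add_pow_mem {R : Type*} [CommRing R] {k : Type*} [CommRing k] [Algebra k R]
    (S : Subalgebra k R) {u v : R} (h₁ : u + v ∈ S) (h₂ : u * v ∈ S) (n : ℕ) :
    u ^ n + v ^ n ∈ S := by
  suffices h : u ^ n + v ^ n ∈ S ∧ u ^ (n + 1) + v ^ (n + 1) ∈ S from h.1
  induction n with
  | zero => exact ⟨by simpa using S.add_mem S.one_mem S.one_mem, by simpa using h₁⟩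
  | succ n ih =>
    refine ⟨ih.2, ?_⟩
    have : u ^ (n + 1 + 1) + v ^ (n + 1 + 1) =
        (u + v) * (u ^ (n + 1) + v ^ (n + 1)) - u * v * (u ^ n + v ^ n) := by ring
    rw [this]
    exact S.sub_mem (S.mul_mem h₁ ih.2) (S.mul_mem h₂ ih.1)

theorem monomial_add_monomial_swapExponent_mem {d : ℕ} (e : Fin 3 →₀ ℕ) (c : F)
    (hle : e 1 ≤ e 2) (hmod : e 1 ≡ e 2 [MOD d]) :
    monomial e c + monomial (swapExponent e) c ∈ (dihedralMap F d).range := by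
  obtain ⟨n, hn⟩ := (Nat.modEq_iff_dvd' hle).1 hmod
  have h2 : e 2 = e 1 + d * n := by omega
  have h : monomial e c + monomial (swapExponent e) c =
      C c * MvPolynomial.X 0 ^ e 0 * (MvPolynomial.X 1 * MvPolynomial.X 2) ^ e 1 *
        ((MvPolynomial.X 1 ^ d) ^ n + (MvPolynomial.X 2 ^ d) ^ n) := by
    rw [monomial_eq, monomial_eq, Finsupp.prod_fintype _ _ (by simp),
      Finsupp.prod_fintype _ _ (by simp)]
    simp only [swapExponent, Fin.prod_univ_three, Finsupp.equivFunOnFinite_symm_apply_apply]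
    simp only [Matrix.cons_val, h2]
    ring
  have h12 : MvPolynomial.X 1 * MvPolynomial.X 2 ∈ (dihedralMap F d).range :=
    ⟨MvPolynomial.X 1, dihedralMap_X_one d⟩
  have h0 : MvPolynomial.X 0 ∈ (dihedralMap F d).range :=
    ⟨MvPolynomial.X 0, dihedralMap_X_zero d⟩
  have hadd : MvPolynomial.X 1 ^ d + MvPolynomial.X 2 ^ d ∈ (dihedralMap F d).range :=
    ⟨MvPolynomial.X 2, dihedralMap_X_two d⟩
  rw [h]
  refine Subalgebra.mul_mem _ (Subalgebra.mul_mem _ (Subalgebra.mul_mem _ ?_ ?_) ?_) ?_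
  · exact Subalgebra.algebraMap_mem (dihedralMap F d).range c
  · exact Subalgebra.pow_mem _ h0 _
  · exact Subalgebra.pow_mem _ h12 _
  · refine pow_add_pow_mem _ hadd ?_ n
    rw [← mul_pow]
    exact Subalgebra.pow_mem _ h12 _

theorem monomial_mem_range_dihedralMap {d : ℕ} (e : Fin 3 →₀ ℕ) (c : F) (heq : e 1 = e 2) :
    monomial e c ∈ (dihedralMap F d).range := by
  refine ⟨C c * MvPolynomial.X 0 ^ e 0 * MvPolynomial.X 1 ^ e 1, ?_⟩
  have h : dihedralMap F d (C c) = C c := (dihedralMap F d).commutes c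
  change dihedralMap F d _ = _
  rw [_root_.map_mul, _root_.map_mul, _root_.map_pow, _root_.map_pow, h, dihedralMap_X_zero,
    dihedralMap_X_one, monomial_eq, Finsupp.prod_fintype _ _ (by simp), Fin.prod_univ_three,
    ← heq]
  ring

theorem mem_range_dihedralMap_iff {α : Fˣ} {p : MvPolynomial (Fin 3) F} :
    p ∈ (dihedralMap F (orderOf α)).range ↔
      polyAct (diagonal ![1, (α : F), ((α⁻¹ : Fˣ) : F)]) p = p ∧
        polyAct (swapMat F) p = p := by
  constructor
  · rintro ⟨q, rfl⟩
    change polyAct _ (dihedralMap F (orderOf α) q) = dihedralMap F (orderOf α) q ∧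
      polyAct _ (dihedralMap F (orderOf α) q) = dihedralMap F (orderOf α) q
    have hα : (α : F) ^ orderOf α = 1 := by
      rw [← Units.val_pow_eq_pow_val, pow_orderOf_eq_one, Units.val_one]
    constructor
    · rw [← AlgHom.comp_apply]
      congr 1
      ext i : 1
      fin_cases i
      · simp [polyAct_X, Matrix.diagonal_apply]
      · simp [polyAct_X, Matrix.diagonal_apply, smul_smul]
      · simp [polyAct_X, Matrix.diagonal_apply, smul_pow, hα]
    · rw [← AlgHom.comp_apply]
      congr 1
      ext i : 1
      fin_cases i
      · simp [polyAct_X, swapMat, Fin.sum_univ_three]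
      · simp [polyAct_X, swapMat, Fin.sum_univ_three, mul_comm]
      · simp [polyAct_X, swapMat, Fin.sum_univ_three, add_comm]
  · rintro ⟨hd, hs⟩
    have hmod : ∀ e ∈ p.support, e 1 ≡ e 2 [MOD orderOf α] := by
      intro e he
      have h := (polyAct_diagonal_eq_iff _ _).1 hd e he
      rw [← pow_eq_pow_iff_modEq, ← mul_inv_eq_one, ← inv_pow]
      ext
      simpa using h
    have hsw : ∀ e, coeff (swapExponent e) p = coeff e p := by
      intro e
      conv_lhs => rw [← hs]
      exact coeff_polyAct_swapMat p e
    have hsupp : ∀ e, e ∈ p.support → swapExponent e ∈ p.support := by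
      intro e he
      rw [mem_support_iff, hsw]
      exact mem_support_iff.1 he
    have hsum : ∑ e ∈ p.support with e 2 < e 1, monomial e (coeff e p) =
        ∑ e ∈ p.support with e 1 < e 2, monomial (swapExponent e) (coeff e p) := by
      refine Finset.sum_nbij' swapExponent swapExponent ?_ ?_ ?_ ?_ ?_
      · intro e he
        rw [Finset.mem_filter] at he ⊢
        exact ⟨hsupp e he.1, by simpa [swapExponent] using he.2⟩
      · intro e he
        rw [Finset.mem_filter] at he ⊢
        exact ⟨hsupp e he.1, by simpa [swapExponent] using he.2⟩
      · exact fun e _ => swapExponent_swapExponent e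
      · exact fun e _ => swapExponent_swapExponent e
      · intro e _
        rw [hsw, swapExponent_swapExponent]
    have hp : p = ∑ e ∈ p.support with e 1 = e 2, monomial e (coeff e p) +
        ∑ e ∈ p.support with e 1 < e 2,
          (monomial e (coeff e p) + monomial (swapExponent e) (coeff e p)) := by
      rw [Finset.sum_add_distrib, ← hsum]
      conv_lhs => rw [p.as_sum]
      rw [← Finset.sum_filter_add_sum_filter_not p.support (fun e => e 1 = e 2)]
      congr 1
      rw [← Finset.sum_filter_add_sum_filter_not (p.support.filter fun e => ¬ e 1 = e 2)
        (fun e => e 1 < e 2), Finset.filter_filter, Finset.filter_filter]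
      congr 2
      · ext e
        simp only [Finset.mem_filter]
        refine and_congr_right fun _ => ?_
        omega
      · ext e
        simp only [Finset.mem_filter]
        refine and_congr_right fun _ => ?_
        omega
    rw [hp]
    refine Subalgebra.add_mem _ (Subalgebra.sum_mem _ ?_) (Subalgebra.sum_mem _ ?_)
    · intro e he
      exact monomial_mem_range_dihedralMap e _ (Finset.mem_filter.1 he).2
    · intro e he
      rw [Finset.mem_filter] at he
      exact monomial_add_monomial_swapExponent_mem e _ he.2.le (hmod e he.1)

theorem polyAct_dihedralMap_eq_iff {d : ℕ} (hd : 0 < d) (l : Fˣ)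
    (q : MvPolynomial (Fin 3) F) :
    polyAct (diagonal ![(l : F)⁻¹ ^ 2, l, l]) (dihedralMap F d q) = dihedralMap F d q ↔
      ∀ e ∈ q.support, WeightZero (orderOf l) d e := by
  have h : (polyAct (diagonal ![(l : F)⁻¹ ^ 2, l, l])).comp (dihedralMap F d) =
      (dihedralMap F d).comp (polyAct (diagonal ![(l : F)⁻¹ ^ 2, (l : F) ^ 2, (l : F) ^ d])) := by
    ext i : 1
    fin_cases i
    · simp [polyAct_X, Matrix.diagonal_apply]
    · simp [polyAct_X, Matrix.diagonal_apply, smul_smul, sq]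
    · simp [polyAct_X, Matrix.diagonal_apply, smul_pow]
  rw [← AlgHom.comp_apply, h, AlgHom.comp_apply, (dihedralMap_injective hd).eq_iff,
    polyAct_diagonal_eq_iff]
  refine forall₂_congr fun e _ => ?_
  rw [WeightZero, ← pow_eq_pow_iff_modEq, Units.ext_iff]
  have hl : (l : F) ^ (2 * e 0) ≠ 0 := pow_ne_zero _ l.ne_zero
  simp only [Matrix.cons_val, Units.val_pow_eq_pow_val]
  rw [pow_add, ← pow_mul, ← pow_mul, ← pow_mul, inv_pow, mul_assoc, inv_mul_eq_one₀ hl, eq_comm]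

end

section
variable {F : Type u} [Field F]

/-- The generators of the monomial group attached to `α` and `l`. -/
def dihedralGenerators (α l : Fˣ) : Set (Matrix (Fin 3) (Fin 3) F) :=
  {diagonal ![1, (α : F), ((α⁻¹ : Fˣ) : F)], swapMat F, diagonal ![(l : F)⁻¹ ^ 2, l, l]}

theorem exists_algHom_mem_range_iff {P S : Type*} [CommRing P] [CommRing S] [Algebra F P]
    [Algebra F S] (Ψ : P →ₐ[F] S) (hΨ : Function.Injective Ψ) {A : Subalgebra F S}
    (hA : A ≤ Ψ.range) :
    ∃ ι : A →ₐ[F] P, Function.Injective ι ∧ ∀ q, q ∈ ι.range ↔ Ψ q ∈ A := by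
  let e := AlgEquiv.ofInjective Ψ hΨ
  let ι : A →ₐ[F] P := (e.symm : Ψ.range →ₐ[F] P).comp (Subalgebra.inclusion hA)
  have hι : Function.Injective ι :=
    e.symm.injective.comp (Subalgebra.inclusion_injective hA)
  have hΨι : ∀ a, Ψ (ι a) = a := fun a =>
    congrArg Subtype.val (e.apply_symm_apply (Subalgebra.inclusion hA a))
  refine ⟨ι, hι, fun q => ⟨?_, fun h => ⟨⟨Ψ q, h⟩, hΨ (hΨι _)⟩⟩⟩
  rintro ⟨a, rfl⟩
  change Ψ (ι a) ∈ _
  rw [hΨι]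
  exact a.2

theorem isGorensteinRing_invariantRing_iff
    {G : Subgroup (Matrix.SpecialLinearGroup (Fin 3) F)} {B B' : Matrix (Fin 3) (Fin 3) F}
    (hB : B * B' = 1) (α l : Fˣ) (hα : 0 < orderOf α) (hl : Odd (orderOf l))
    (h₁ : ∀ M ∈ dihedralGenerators α l, ∃ g ∈ G, B * (g : Matrix (Fin 3) (Fin 3) F) = M * B)
    (h₂ : ∀ g ∈ G, ∃ M ∈ Submonoid.closure (dihedralGenerators α l),
      B * (g : Matrix (Fin 3) (Fin 3) F) = M * B) :
    IsGorensteinRing ↥(invariantRing G) ↔ orderOf l ∣ orderOf α := by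
  have hinjB := polyAct_injective hB
  have hB' : B' * B = 1 := mul_eq_one_comm.1 hB
  have hmem : ∀ p, polyAct B p ∈ invariantRing G ↔
      ∀ M ∈ dihedralGenerators α l, polyAct M p = p := by
    intro p
    have hact : ∀ (g M : Matrix (Fin 3) (Fin 3) F), B * g = M * B →
        (polyAct g (polyAct B p) = polyAct B p ↔ polyAct M p = p) := by
      intro g M h
      rw [← polyAct_mul_apply, h, polyAct_mul_apply, hinjB.eq_iff]
    constructor
    · intro h M hM
      obtain ⟨g, hg, hgM⟩ := h₁ M hM
      exact (hact _ _ hgM).1 (h _ ⟨g, hg, rfl⟩)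
    · rintro h _ ⟨g, hg, rfl⟩
      obtain ⟨M, hM, hgM⟩ := h₂ g hg
      refine (hact _ _ hgM).2 ?_
      have hle : Submonoid.closure (dihedralGenerators α l) ≤ polyFixing p :=
        (Submonoid.closure_le).2 h
      exact mem_polyFixing.1 (hle hM)
  obtain ⟨ι, hι, hrange⟩ := exists_algHom_mem_range_iff
    ((polyAct B).comp (dihedralMap F (orderOf α))) (A := invariantRing G)
    (hinjB.comp (dihedralMap_injective hα)) (by
      intro p hp
      have hpB : polyAct B (polyAct B' p) = p := by
        rw [← polyAct_mul_apply, hB', polyAct_one]; rfl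
      rw [← hpB, hmem] at hp
      obtain ⟨q, hq⟩ := mem_range_dihedralMap_iff.2
        ⟨hp (diagonal ![1, (α : F), ((α⁻¹ : Fˣ) : F)]) (by simp [dihedralGenerators]),
          hp (swapMat F) (by simp [dihedralGenerators])⟩
      have hq' : dihedralMap F (orderOf α) q = polyAct B' p := hq
      exact ⟨q, (congrArg (polyAct B) hq').trans hpB⟩)
  refine isGorensteinRing_iff_dvd hι (fun q => ?_) hl
  have hq : dihedralMap F (orderOf α) q ∈ (dihedralMap F (orderOf α)).range := ⟨q, rfl⟩
  rw [mem_range_dihedralMap_iff] at hq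
  rw [hrange, ← polyAct_dihedralMap_eq_iff hα, AlgHom.comp_apply, hmem]
  constructor
  · intro h
    exact h _ (by simp [dihedralGenerators])
  · rintro h M (rfl | rfl | rfl)
    exacts [hq.1, hq.2, h]

end

/-! ### Block matrices relative to a basis of the plane -/

section
variable {F : Type u} [Field F]

/-- The block matrix with blocks `a` and `!![p, q; r, s]`. -/
def blockMat (a p q r s : F) : Matrix (Fin 3) (Fin 3) F :=
  !![a, 0, 0; 0, p, q; 0, r, s]

theorem blockMat_mul (a p q r s a' p' q' r' s' : F) :
    blockMat a p q r s * blockMat a' p' q' r' s' =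
      blockMat (a * a') (p * p' + q * r') (p * q' + q * s') (r * p' + s * r')
        (r * q' + s * s') := by
  ext i j
  fin_cases i <;> fin_cases j <;> simp [blockMat, Matrix.mul_apply, Fin.sum_univ_three]

theorem blockMat_inj {a p q r s a' p' q' r' s' : F} :
    blockMat a p q r s = blockMat a' p' q' r' s' ↔
      a = a' ∧ p = p' ∧ q = q' ∧ r = r' ∧ s = s' := by
  constructor
  · intro h
    have h' := fun i j => congrFun (congrFun h i) j
    exact ⟨by simpa [blockMat] using h' 0 0, by simpa [blockMat] using h' 1 1,
      by simpa [blockMat] using h' 1 2, by simpa [blockMat] using h' 2 1,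
      by simpa [blockMat] using h' 2 2⟩
  · rintro ⟨rfl, rfl, rfl, rfl, rfl⟩
    rfl

theorem blockMat_one : blockMat (1 : F) 1 0 0 1 = 1 := by
  ext i j
  fin_cases i <;> fin_cases j <;> simp [blockMat]

theorem det_blockMat (a p q r s : F) : (blockMat a p q r s).det = a * (p * s - q * r) := by
  simp [blockMat, Matrix.det_fin_three]
  ring

/-- The block matrix whose rows are the vectors of a basis adapted to the plane. -/
def planeBasis (w₁ w₂ : Fin 2 → F) : Matrix (Fin 3) (Fin 3) F :=
  blockMat 1 (w₁ 0) (w₁ 1) (w₂ 0) (w₂ 1)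

theorem isUnit_planeBasis {w₁ w₂ : Fin 2 → F} (hw : LinearIndependent F ![w₁, w₂]) :
    IsUnit (planeBasis w₁ w₂) := by
  have h : IsUnit (Matrix.of ![w₁, w₂]) := by
    rw [← Matrix.linearIndependent_rows_iff_isUnit]
    exact hw
  rw [Matrix.isUnit_iff_isUnit_det, Matrix.det_fin_two] at h
  rw [Matrix.isUnit_iff_isUnit_det, planeBasis, det_blockMat, one_mul]
  simpa using h

/-- The elements of `SL(3, F)` preserving the decomposition `F ⊕ F²`. -/
def IsBlock (g : Matrix.SpecialLinearGroup (Fin 3) F) : Prop :=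
  (g : Matrix (Fin 3) (Fin 3) F) 0 1 = 0 ∧ (g : Matrix (Fin 3) (Fin 3) F) 0 2 = 0 ∧
    (g : Matrix (Fin 3) (Fin 3) F) 1 0 = 0 ∧ (g : Matrix (Fin 3) (Fin 3) F) 2 0 = 0

theorem IsBlock.eq_blockMat {g : Matrix.SpecialLinearGroup (Fin 3) F} (hg : IsBlock g) :
    (g : Matrix (Fin 3) (Fin 3) F) =
      blockMat (g 0 0) (subW g 0 0) (subW g 0 1) (subW g 1 0) (subW g 1 1) := by
  obtain ⟨h1, h2, h3, h4⟩ := hg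
  ext i j
  fin_cases i <;> fin_cases j <;> simp [blockMat, subW, h1, h2, h3, h4]

/-- `M` is the matrix of `g` in the basis given by the rows of `B`. -/
def IsMatrixIn (B : Matrix (Fin 3) (Fin 3) F) (g : Matrix.SpecialLinearGroup (Fin 3) F)
    (M : Matrix (Fin 3) (Fin 3) F) : Prop :=
  B * (g : Matrix (Fin 3) (Fin 3) F) = M * B

theorem isMatrixIn_blockMat_iff {w₁ w₂ : Fin 2 → F} {g : Matrix.SpecialLinearGroup (Fin 3) F}
    (hg : IsBlock g) (a p q r s : F) :
    IsMatrixIn (planeBasis w₁ w₂) g (blockMat a p q r s) ↔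
      (g : Matrix (Fin 3) (Fin 3) F) 0 0 = a ∧
        w₁ ᵥ* subW g = p • w₁ + q • w₂ ∧ w₂ ᵥ* subW g = r • w₁ + s • w₂ := by
  rw [IsMatrixIn, hg.eq_blockMat, planeBasis, blockMat_mul, blockMat_mul, blockMat_inj]
  simp only [funext_iff, Fin.forall_fin_two, Matrix.vecMul, dotProduct, Fin.sum_univ_two,
    Pi.add_apply, Pi.smul_apply, smul_eq_mul, mul_one, one_mul]
  simp only [blockMat]
  simp
  tauto

variable {B : Matrix (Fin 3) (Fin 3) F} {g h : Matrix.SpecialLinearGroup (Fin 3) F}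
  {M N : Matrix (Fin 3) (Fin 3) F}

theorem IsMatrixIn.mul (hM : IsMatrixIn B g M) (hN : IsMatrixIn B h N) :
    IsMatrixIn B (g * h) (M * N) := by
  unfold IsMatrixIn at *
  rw [Matrix.SpecialLinearGroup.coe_mul, ← mul_assoc, hM, mul_assoc, hN, mul_assoc]

theorem isMatrixIn_one (B : Matrix (Fin 3) (Fin 3) F) : IsMatrixIn B 1 1 := by
  simp [IsMatrixIn]

theorem IsMatrixIn.inv (hM : IsMatrixIn B g M) (hMN : N * M = 1) : IsMatrixIn B g⁻¹ N := by
  unfold IsMatrixIn at *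
  have h1 : (g : Matrix (Fin 3) (Fin 3) F) * (g⁻¹ : Matrix.SpecialLinearGroup (Fin 3) F) = 1 := by
    rw [← Matrix.SpecialLinearGroup.coe_mul, mul_inv_cancel, Matrix.SpecialLinearGroup.coe_one]
  calc B * (g⁻¹ : Matrix.SpecialLinearGroup (Fin 3) F)
      = N * (M * B) * (g⁻¹ : Matrix.SpecialLinearGroup (Fin 3) F) := by
        rw [← mul_assoc, hMN, one_mul]
    _ = N * B := by rw [← hM, mul_assoc, mul_assoc, h1, mul_one]

theorem IsMatrixIn.unique (hB : IsUnit B) (hM : IsMatrixIn B g M) (hN : IsMatrixIn B g N) :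
    M = N :=
  hB.mul_right_cancel (hM.symm.trans hN)

theorem IsMatrixIn.eq_of_eq (hB : IsUnit B) (hM : IsMatrixIn B g M) (hN : IsMatrixIn B h M) :
    g = h :=
  Subtype.ext (hB.mul_left_cancel (hM.trans hN.symm))

theorem IsMatrixIn.det_eq_one (hB : IsUnit B) (hM : IsMatrixIn B g M) : M.det = 1 := by
  have h := congrArg Matrix.det hM
  rw [Matrix.det_mul, Matrix.det_mul, g.2, mul_one] at h
  rw [Matrix.isUnit_iff_isUnit_det] at hB
  exact hB.mul_right_cancel (by rw [one_mul]; exact h.symm)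

end

/-! ### The transvection subgroup -/

section
variable {F : Type u} [Field F] {G : Subgroup (Matrix.SpecialLinearGroup (Fin 3) F)}

theorem transSubgroup_le {m : ℕ} (G : Subgroup (Matrix.SpecialLinearGroup (Fin m) F)) :
    transSubgroup G ≤ G :=
  (Subgroup.closure_le G).2 fun _ h => h.1

theorem IsTransvectionMat.conj {m : ℕ} {g t : Matrix.SpecialLinearGroup (Fin m) F}
    (ht : IsTransvectionMat (t : Matrix (Fin m) (Fin m) F)) :
    IsTransvectionMat ((g * t * g⁻¹ : Matrix.SpecialLinearGroup (Fin m) F) :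
      Matrix (Fin m) (Fin m) F) := by
  have h1 : (g : Matrix (Fin m) (Fin m) F) * (g⁻¹ : Matrix.SpecialLinearGroup (Fin m) F) = 1 := by
    rw [← Matrix.SpecialLinearGroup.coe_mul, mul_inv_cancel, Matrix.SpecialLinearGroup.coe_one]
  have h2 : ((g⁻¹ : Matrix.SpecialLinearGroup (Fin m) F) : Matrix (Fin m) (Fin m) F) * g = 1 := by
    rw [← Matrix.SpecialLinearGroup.coe_mul, inv_mul_cancel, Matrix.SpecialLinearGroup.coe_one]
  have h3 : ((g * t * g⁻¹ : Matrix.SpecialLinearGroup (Fin m) F) : Matrix (Fin m) (Fin m) F) - 1 =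
      g * ((t : Matrix (Fin m) (Fin m) F) - 1) *
        (g⁻¹ : Matrix.SpecialLinearGroup (Fin m) F) := by
    rw [Matrix.SpecialLinearGroup.coe_mul, Matrix.SpecialLinearGroup.coe_mul, mul_sub, sub_mul,
      mul_one, h1]
  unfold IsTransvectionMat at *
  rw [h3]
  constructor
  · rw [Matrix.rank_mul_eq_left_of_isUnit_det, Matrix.rank_mul_eq_right_of_isUnit_det, ht.1]
    · rw [g.2]; exact isUnit_one
    · rw [(g⁻¹).2]; exact isUnit_one
  · calc _ = (g : Matrix (Fin m) (Fin m) F) * ((t : Matrix (Fin m) (Fin m) F) - 1) *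
          (((g⁻¹ : Matrix.SpecialLinearGroup (Fin m) F) : Matrix (Fin m) (Fin m) F) * g) *
          ((t : Matrix (Fin m) (Fin m) F) - 1) * (g⁻¹ : Matrix.SpecialLinearGroup (Fin m) F) := by
          simp only [mul_assoc]
      _ = g * (((t : Matrix (Fin m) (Fin m) F) - 1) * ((t : Matrix (Fin m) (Fin m) F) - 1)) *
          (g⁻¹ : Matrix.SpecialLinearGroup (Fin m) F) := by
          rw [h2, mul_one]; simp only [mul_assoc]
      _ = 0 := by rw [ht.2, mul_zero, zero_mul]

theorem conj_mem_transSubgroup {m : ℕ} {G : Subgroup (Matrix.SpecialLinearGroup (Fin m) F)}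
    {g t : Matrix.SpecialLinearGroup (Fin m) F} (hg : g ∈ G) (ht : t ∈ transSubgroup G) :
    g * t * g⁻¹ ∈ transSubgroup G := by
  have h : transSubgroup G ≤ (transSubgroup G).comap (MulAut.conj g).toMonoidHom := by
    refine (Subgroup.closure_le _).2 fun x hx => ?_
    exact Subgroup.subset_closure
      ⟨G.mul_mem (G.mul_mem hg hx.1) (G.inv_mem hg), hx.2.conj⟩
  exact h ht

theorem apply_zero_zero_of_mem_transSubgroup (hblock : ∀ g ∈ G, IsBlock g)
    {t : Matrix.SpecialLinearGroup (Fin 3) F} (ht : t ∈ transSubgroup G) :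
    (t : Matrix (Fin 3) (Fin 3) F) 0 0 = 1 := by
  have hmul : ∀ x ∈ G, ∀ y : Matrix.SpecialLinearGroup (Fin 3) F,
      ((x * y : Matrix.SpecialLinearGroup (Fin 3) F) : Matrix (Fin 3) (Fin 3) F) 0 0 =
        (x : Matrix (Fin 3) (Fin 3) F) 0 0 * (y : Matrix (Fin 3) (Fin 3) F) 0 0 := by
    intro x hx y
    rw [Matrix.SpecialLinearGroup.coe_mul, Matrix.mul_apply, Fin.sum_univ_three,
      (hblock x hx).1, (hblock x hx).2.1]
    ring
  induction ht using Subgroup.closure_induction with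
  | mem x hx =>
    obtain ⟨hxG, -, h⟩ := hx
    have h00 := congrFun (congrFun h 0) 0
    rw [Matrix.mul_apply, Fin.sum_univ_three] at h00
    simp only [Matrix.sub_apply, (hblock x hxG).1, (hblock x hxG).2.1] at h00
    simpa [sub_eq_zero] using h00
  | one => simp
  | mul x y hx _ ihx ihy =>
    rw [hmul x (transSubgroup_le G hx), ihx, ihy, mul_one]
  | inv x hx ih =>
    have h := hmul x (transSubgroup_le G hx) x⁻¹
    rw [mul_inv_cancel, ih, one_mul] at h
    simpa using h.symm

/-- The diagonal matrix `diag(1, a, a⁻¹)`. -/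
def diagHom (F : Type u) [Field F] : Fˣ →* Matrix (Fin 3) (Fin 3) F where
  toFun a := blockMat 1 (a : F) 0 0 (a : F)⁻¹
  map_one' := by simp [blockMat_one]
  map_mul' a b := by rw [blockMat_mul, blockMat_inj]; simp [mul_comm]

/-- The diagonal matrix `diag(a⁻², a, a)`. -/
def scalarHom (F : Type u) [Field F] : Fˣ →* Matrix (Fin 3) (Fin 3) F where
  toFun a := blockMat ((a : F)⁻¹ ^ 2) a 0 0 a
  map_one' := by simp [blockMat_one]
  map_mul' a b := by rw [blockMat_mul, blockMat_inj]; simp [mul_comm, mul_pow]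

theorem diagHom_apply (a : Fˣ) : diagHom F a = blockMat 1 (a : F) 0 0 (a : F)⁻¹ := rfl

theorem scalarHom_apply (a : Fˣ) : scalarHom F a = blockMat ((a : F)⁻¹ ^ 2) a 0 0 a := rfl

theorem diagHom_injective : Function.Injective (diagHom F) := by
  intro a b h
  exact Units.ext (blockMat_inj.1 h).2.1

theorem scalarHom_injective : Function.Injective (scalarHom F) := by
  intro a b h
  exact Units.ext (blockMat_inj.1 h).2.1

theorem swapMat_eq : swapMat F = blockMat 1 0 1 1 0 := rfl

theorem diagHom_mul_swapMat (a : Fˣ) :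
    diagHom F a * swapMat F = blockMat 1 0 (a : F) (a : F)⁻¹ 0 := by
  rw [diagHom_apply, swapMat_eq, blockMat_mul, blockMat_inj]
  simp

theorem swapMat_mul_diagHom (a : Fˣ) :
    swapMat F * diagHom F a = diagHom F a⁻¹ * swapMat F := by
  rw [diagHom_mul_swapMat, diagHom_apply, swapMat_eq, blockMat_mul, blockMat_inj]
  simp

theorem swapMat_mul_swapMat : swapMat F * swapMat F = 1 := by
  rw [swapMat_eq, blockMat_mul, ← blockMat_one, blockMat_inj]
  simp

theorem Units.eq_one_of_sq_eq_one [CharP F 2] {a : Fˣ} (h : a ^ 2 = 1) : a = 1 := by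
  ext
  have h1 : (a : F) ^ 2 = 1 := by rw [← Units.val_pow_eq_pow_val, h, Units.val_one]
  rcases sq_eq_one_iff.1 h1 with h2 | h2
  · exact h2
  · rw [h2, CharTwo.neg_eq, Units.val_one]

theorem Units.odd_orderOf [CharP F 2] {a : Fˣ} (h : 0 < orderOf a) : Odd (orderOf a) := by
  by_contra hodd
  obtain ⟨k, hk⟩ := Nat.not_odd_iff_even.1 hodd
  have h1 : a ^ k = 1 := Units.eq_one_of_sq_eq_one (by
    rw [← pow_mul, mul_two, ← hk, pow_orderOf_eq_one])
  have := Nat.le_of_dvd (by omega) (orderOf_dvd_of_pow_eq_one h1)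
  omega

end

section
variable {F : Type u} [Field F]

/-- The units whose image under `φ` is the matrix of some element of `H`. -/
def unitsIn (B : Matrix (Fin 3) (Fin 3) F) (φ : Fˣ →* Matrix (Fin 3) (Fin 3) F)
    (H : Subgroup (Matrix.SpecialLinearGroup (Fin 3) F)) : Subgroup Fˣ where
  carrier := {a | ∃ t ∈ H, IsMatrixIn B t (φ a)}
  one_mem' := ⟨1, H.one_mem, by rw [_root_.map_one]; exact isMatrixIn_one B⟩
  mul_mem' := by
    rintro a b ⟨t, ht, hta⟩ ⟨s, hs, hsb⟩
    exact ⟨t * s, H.mul_mem ht hs, by rw [_root_.map_mul]; exact hta.mul hsb⟩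
  inv_mem' := by
    rintro a ⟨t, ht, hta⟩
    exact ⟨t⁻¹, H.inv_mem ht, hta.inv (by rw [← _root_.map_mul, inv_mul_cancel, _root_.map_one])⟩

theorem exists_generator_unitsIn {B : Matrix (Fin 3) (Fin 3) F} (hB : IsUnit B)
    {φ : Fˣ →* Matrix (Fin 3) (Fin 3) F} (hφ : Function.Injective φ)
    (H : Subgroup (Matrix.SpecialLinearGroup (Fin 3) F)) [Finite H] :
    ∃ α : Fˣ, 0 < orderOf α ∧
      ∀ a, (∃ t ∈ H, IsMatrixIn B t (φ a)) ↔ ∃ n : ℕ, a = α ^ n := by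
  have hfin : Finite (unitsIn B φ H) := by
    choose f hfH hf using fun a : unitsIn B φ H => a.2
    refine Finite.of_injective (fun a => (⟨f a, hfH a⟩ : H)) fun a b hab => ?_
    have h : f a = f b := congrArg Subtype.val hab
    exact Subtype.ext (hφ ((hf a).unique hB (h ▸ hf b)))
  obtain ⟨α, hα⟩ := IsCyclic.exists_generator (α := unitsIn B φ H)
  have hpos : 0 < orderOf (α : Fˣ) := by
    rw [Subgroup.orderOf_coe]; exact orderOf_pos α
  refine ⟨α, hpos, fun a => ⟨fun ha => ?_, ?_⟩⟩
  · obtain ⟨n, hn⟩ := (mem_powers_iff_mem_zpowers).2 (hα ⟨a, ha⟩)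
    exact ⟨n, by simpa using (congrArg Subtype.val hn).symm⟩
  · rintro ⟨n, rfl⟩
    exact ((unitsIn B φ H).pow_mem α.2 n : _)

/-- In the basis `B`, the subgroup `T` is a group of monomial matrices as in the dihedral case,
it is normal in `G`, and `G` preserves the block structure. -/
structure IsDihedralPair (B : Matrix (Fin 3) (Fin 3) F)
    (T G : Subgroup (Matrix.SpecialLinearGroup (Fin 3) F)) : Prop where
  isUnit : IsUnit B
  le : T ≤ G
  conj_mem : ∀ g ∈ G, ∀ t ∈ T, g * t * g⁻¹ ∈ T
  exists_blockMat : ∀ g ∈ G, ∃ a p q r s, IsMatrixIn B g (blockMat a p q r s)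
  diag_or_anti : ∀ t ∈ T, ∃ a : Fˣ,
    IsMatrixIn B t (diagHom F a) ∨ IsMatrixIn B t (diagHom F a * swapMat F)
  exists_swap : ∃ t ∈ T, IsMatrixIn B t (swapMat F)
  exists_ne_one : ∃ a : Fˣ, a ≠ 1 ∧ ∃ t ∈ T, IsMatrixIn B t (diagHom F a)

variable {B : Matrix (Fin 3) (Fin 3) F} {T G : Subgroup (Matrix.SpecialLinearGroup (Fin 3) F)}

theorem diagHom_mul_swapMat_mul (a b : Fˣ) :
    diagHom F a * swapMat F * (diagHom F b * swapMat F) = diagHom F (a * b⁻¹) := by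
  rw [mul_assoc, ← mul_assoc (swapMat F), swapMat_mul_diagHom, mul_assoc, swapMat_mul_swapMat,
    mul_one, ← _root_.map_mul]

theorem IsDihedralPair.exists_diagonal (h : IsDihedralPair B T G) [CharP F 2]
    {g : Matrix.SpecialLinearGroup (Fin 3) F} (hg : g ∈ G) :
    ∃ t ∈ T, ∃ a b c, IsMatrixIn B (g * t) (blockMat a b 0 0 c) := by
  obtain ⟨a, p, q, r, s, hM⟩ := h.exists_blockMat g hg
  obtain ⟨α, hα, t, ht, htα⟩ := h.exists_ne_one
  have hα2 : (α : F) ^ 2 ≠ 1 := fun h2 => hα (Units.eq_one_of_sq_eq_one (by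
    ext; rw [Units.val_pow_eq_pow_val, h2, Units.val_one]))
  have hα0 : (α : F) ≠ 0 := α.ne_zero
  obtain ⟨η, hη⟩ := h.diag_or_anti _ (h.conj_mem g hg t ht)
  have hη0 : (η : F) ≠ 0 := η.ne_zero
  have hηd : IsMatrixIn B (g * t * g⁻¹) (diagHom F η) := by
    refine hη.resolve_right fun hanti => hα2 ?_
    have h1 := hanti.mul hanti
    rw [diagHom_mul_swapMat_mul, mul_inv_cancel, _root_.map_one] at h1
    have h2 : g * t * g⁻¹ * (g * t * g⁻¹) = 1 := h1.eq_of_eq h.isUnit (isMatrixIn_one B)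
    have h3 : t * t = 1 := by
      have : t * t = g⁻¹ * (g * t * g⁻¹ * (g * t * g⁻¹)) * g := by group
      rw [this, h2]; group
    have h4 := htα.mul htα
    rw [h3, ← _root_.map_mul] at h4
    have h5 := h4.unique h.isUnit (isMatrixIn_one B)
    rw [← _root_.map_one (diagHom F)] at h5
    have h6 := congrArg Units.val (diagHom_injective h5)
    rw [sq]
    simpa using h6
  have hcomm : blockMat a p q r s * diagHom F α = diagHom F η * blockMat a p q r s := by
    refine (hM.mul htα).unique h.isUnit ?_
    have := hηd.mul hM
    rwa [inv_mul_cancel_right] at this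
  rw [diagHom_apply, diagHom_apply, blockMat_mul, blockMat_mul, blockMat_inj] at hcomm
  obtain ⟨-, e1, e2, e3, e4⟩ := hcomm
  simp only [mul_zero, zero_mul, add_zero, zero_add] at e1 e2 e3 e4
  have hdet := hM.det_eq_one h.isUnit
  rw [det_blockMat] at hdet
  by_cases hp : p = 0
  · subst hp
    have hq : q ≠ 0 := by rintro rfl; simp at hdet
    have hηα : (η : F) = (α : F)⁻¹ := by
      apply mul_right_cancel₀ hq
      rw [← e2, mul_comm]
    rw [hηα, inv_inv] at e4
    have hs : s = 0 := by
      by_contra hs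
      apply hα2
      rw [mul_comm] at e4
      have := mul_right_cancel₀ hs e4
      rw [sq]
      nth_rw 1 [← this]
      exact inv_mul_cancel₀ hα0
    obtain ⟨τ, hτ, hτσ⟩ := h.exists_swap
    refine ⟨τ, hτ, a, q, r, ?_⟩
    have h1 := hM.mul hτσ
    rw [swapMat_eq, blockMat_mul] at h1
    simpa [hs] using h1
  · have hηα : (η : F) = α := by
      apply mul_right_cancel₀ hp
      rw [← e1, mul_comm]
    rw [hηα] at e2 e3
    have hq : q = 0 := by
      by_contra hq
      apply hα2
      rw [mul_comm] at e2
      have := mul_right_cancel₀ hq e2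
      rw [sq]
      nth_rw 1 [← this]
      exact inv_mul_cancel₀ hα0
    have hr : r = 0 := by
      by_contra hr
      apply hα2
      rw [mul_comm] at e3
      have := mul_right_cancel₀ hr e3
      rw [sq]
      nth_rw 1 [this]
      exact inv_mul_cancel₀ hα0
    refine ⟨1, T.one_mem, a, p, s, ?_⟩
    rw [mul_one]
    simpa [hq, hr] using hM

theorem IsDihedralPair.exists_scalar_mul (h : IsDihedralPair B T G) [CharP F 2] {α : Fˣ}
    (hα0 : 0 < orderOf α)
    (hα : ∀ a, (∃ t ∈ T, IsMatrixIn B t (diagHom F a)) ↔ ∃ n : ℕ, a = α ^ n)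
    {g : Matrix.SpecialLinearGroup (Fin 3) F} (hg : g ∈ G) :
    ∃ l : Fˣ, ∃ k ∈ G, IsMatrixIn B k (scalarHom F l) ∧ ∃ t ∈ T, g = k * t := by
  obtain ⟨t, ht, a, b, c, hgt⟩ := h.exists_diagonal hg
  obtain ⟨τ, hτ, hτσ⟩ := h.exists_swap
  have hgtG : g * t ∈ G := G.mul_mem hg (h.le ht)
  have hdet := hgt.det_eq_one h.isUnit
  rw [det_blockMat] at hdet
  simp only [mul_zero, sub_zero] at hdet
  have hb : b ≠ 0 := by rintro rfl; simp at hdet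
  have hc : c ≠ 0 := by rintro rfl; simp at hdet
  have hconj := h.conj_mem _ hgtG _ hτ
  have hinv : IsMatrixIn B (g * t)⁻¹ (blockMat a⁻¹ b⁻¹ 0 0 c⁻¹) := hgt.inv (by
    have ha : a ≠ 0 := by rintro rfl; simp at hdet
    rw [blockMat_mul, ← blockMat_one, blockMat_inj]
    simp [ha, hb, hc])
  have ha : a ≠ 0 := by rintro rfl; simp at hdet
  have hmem : IsMatrixIn B (g * t * τ * (g * t)⁻¹ * τ)
      (diagHom F (Units.mk0 b hb * (Units.mk0 c hc)⁻¹)) := by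
    have h1 := ((hgt.mul hτσ).mul hinv).mul hτσ
    rw [swapMat_eq, blockMat_mul, blockMat_mul, blockMat_mul] at h1
    rw [diagHom_apply]
    convert h1 using 2 <;> simp [ha, mul_comm]
  obtain ⟨n, hn⟩ := (hα _).1 ⟨_, T.mul_mem hconj hτ, hmem⟩
  obtain ⟨j, hj⟩ := Units.odd_orderOf hα0
  have hsq : Units.mk0 b hb * (Units.mk0 c hc)⁻¹ = (α ^ (n * (j + 1))) ^ 2 := by
    have : n * (j + 1) * 2 = n + orderOf α * n := by rw [hj]; ring
    rw [hn, ← pow_mul, this, pow_add, pow_mul α (orderOf α), pow_orderOf_eq_one, one_pow, mul_one]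
  set η := α ^ (n * (j + 1)) with hη
  obtain ⟨s, hs, hsη⟩ := (hα η).2 ⟨_, hη⟩
  have hsinv : IsMatrixIn B s⁻¹ (diagHom F η⁻¹) :=
    hsη.inv (by rw [← _root_.map_mul, inv_mul_cancel, _root_.map_one])
  have hη0 : (η : F) ≠ 0 := η.ne_zero
  have hbc : b = c * (η : F) ^ 2 := by
    have := congrArg Units.val hsq
    simp only [Units.val_mul, Units.val_mk0, Units.val_inv_eq_inv_val,
      Units.val_pow_eq_pow_val] at this
    rw [← this]
    field_simp
  refine ⟨Units.mk0 c hc * η, g * t * s⁻¹, G.mul_mem hgtG (h.le (T.inv_mem hs)), ?_,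
    s * t⁻¹, T.mul_mem hs (T.inv_mem ht), by group⟩
  have h1 := hgt.mul hsinv
  rw [diagHom_apply, blockMat_mul] at h1
  have hac : a = (c * (η : F))⁻¹ ^ 2 := by
    rw [hbc] at hdet
    rw [inv_pow]
    refine eq_inv_of_mul_eq_one_left ?_
    rw [← hdet]
    ring
  rw [scalarHom_apply]
  convert h1 using 2
  · simp [hac]
  · rw [hbc]; simp; field_simp
  · simp
  · simp
  · simp

end

section
variable {F : Type u} [Field F] {B : Matrix (Fin 3) (Fin 3) F}
  {T G : Subgroup (Matrix.SpecialLinearGroup (Fin 3) F)}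

theorem IsDihedralPair.exists_diagHom_of_mem_commutator (h : IsDihedralPair B T G)
    {τ : Matrix.SpecialLinearGroup (Fin 3) F} (hτ : τ ∈ ⁅T, T⁆) :
    ∃ a : Fˣ, IsMatrixIn B τ (diagHom F a) := by
  let K : Subgroup (Matrix.SpecialLinearGroup (Fin 3) F) :=
    { carrier := {t | ∃ a : Fˣ, IsMatrixIn B t (diagHom F a)}
      one_mem' := ⟨1, by rw [_root_.map_one]; exact isMatrixIn_one B⟩
      mul_mem' := by
        rintro s t ⟨a, ha⟩ ⟨b, hb⟩
        exact ⟨a * b, by rw [_root_.map_mul]; exact ha.mul hb⟩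
      inv_mem' := by
        rintro t ⟨a, ha⟩
        exact ⟨a⁻¹, ha.inv (by rw [← _root_.map_mul, inv_mul_cancel, _root_.map_one])⟩ }
  let anti : Matrix.SpecialLinearGroup (Fin 3) F → Prop := fun t =>
    ∃ a : Fˣ, IsMatrixIn B t (diagHom F a * swapMat F)
  have hor : ∀ t ∈ T, t ∈ K ∨ anti t := by
    intro t ht
    obtain ⟨a, ha | ha⟩ := h.diag_or_anti t ht
    exacts [Or.inl ⟨a, ha⟩, Or.inr ⟨a, ha⟩]
  have hinv : ∀ t, anti t → anti t⁻¹ := by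
    rintro t ⟨a, ha⟩
    exact ⟨a, ha.inv (by rw [diagHom_mul_swapMat_mul, mul_inv_cancel, _root_.map_one])⟩
  have hKa : ∀ s ∈ K, ∀ t, anti t → anti (s * t) := by
    rintro s ⟨a, ha⟩ t ⟨b, hb⟩
    exact ⟨a * b, by rw [_root_.map_mul, mul_assoc]; exact ha.mul hb⟩
  have haK : ∀ s, anti s → ∀ t ∈ K, anti (s * t) := by
    rintro s ⟨a, ha⟩ t ⟨b, hb⟩
    refine ⟨a * b⁻¹, ?_⟩
    rw [_root_.map_mul, mul_assoc, ← swapMat_mul_diagHom, ← mul_assoc]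
    exact ha.mul hb
  have haa : ∀ s, anti s → ∀ t, anti t → s * t ∈ K := by
    rintro s ⟨a, ha⟩ t ⟨b, hb⟩
    exact ⟨a * b⁻¹, by rw [← diagHom_mul_swapMat_mul]; exact ha.mul hb⟩
  have hle : ⁅T, T⁆ ≤ K := by
    rw [Subgroup.commutator_le]
    intro s hs t ht
    rw [commutatorElement_def]
    rcases hor s hs with hs | hs <;> rcases hor t ht with ht | ht
    · exact K.mul_mem (K.mul_mem (K.mul_mem hs ht) (K.inv_mem hs)) (K.inv_mem ht)
    · exact haa _ (haK _ (hKa _ hs _ ht) _ (K.inv_mem hs)) _ (hinv _ ht)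
    · exact K.mul_mem (haa _ (haK _ hs _ ht) _ (hinv _ hs)) (K.inv_mem ht)
    · exact haa _ (hKa _ (haa _ hs _ ht) _ (hinv _ hs)) _ (hinv _ ht)
  exact hle hτ

theorem IsDihedralPair.exists_mem_commutator (h : IsDihedralPair B T G) [CharP F 2] {α : Fˣ}
    (hα0 : 0 < orderOf α) (hα : ∃ t ∈ T, IsMatrixIn B t (diagHom F α)) (n : ℕ) :
    ∃ τ ∈ ⁅T, T⁆, IsMatrixIn B τ (diagHom F (α ^ n)) := by
  obtain ⟨t, ht, htα⟩ := hα
  obtain ⟨σ, hσ, hσm⟩ := h.exists_swap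
  obtain ⟨j, hj⟩ := Units.odd_orderOf hα0
  have hinv : IsMatrixIn B t⁻¹ (diagHom F α⁻¹) :=
    htα.inv (by rw [← _root_.map_mul, inv_mul_cancel, _root_.map_one])
  have h1 : IsMatrixIn B (t * σ * t⁻¹ * σ⁻¹) (diagHom F (α ^ 2)) := by
    have h2 := ((htα.mul hσm).mul hinv).mul (hσm.inv swapMat_mul_swapMat)
    rwa [mul_assoc (diagHom F α), swapMat_mul_diagHom, inv_inv, mul_assoc (diagHom F α),
      mul_assoc (diagHom F α), swapMat_mul_swapMat, mul_one, ← _root_.map_mul, ← sq] at h2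
  have hpow : ∀ k : ℕ, IsMatrixIn B ((t * σ * t⁻¹ * σ⁻¹) ^ k) (diagHom F ((α ^ 2) ^ k)) := by
    intro k
    induction k with
    | zero => simpa using isMatrixIn_one B
    | succ k ih =>
      rw [pow_succ, pow_succ, _root_.map_mul]
      exact ih.mul h1
  refine ⟨(t * σ * t⁻¹ * σ⁻¹) ^ ((j + 1) * n),
    Subgroup.pow_mem _ (Subgroup.commutator_mem_commutator ht hσ) _, ?_⟩
  convert hpow ((j + 1) * n) using 2
  have : 2 * ((j + 1) * n) = n + orderOf α * n := by rw [hj]; ring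
  rw [← pow_mul, this, pow_add, pow_mul α (orderOf α), pow_orderOf_eq_one, one_pow, mul_one]

theorem IsDihedralPair.isGorensteinRing_iff (h : IsDihedralPair B T G) [CharP F 2] {α l : Fˣ}
    (hα0 : 0 < orderOf α)
    (hα : ∀ a, (∃ t ∈ T, IsMatrixIn B t (diagHom F a)) ↔ ∃ n : ℕ, a = α ^ n)
    (hl0 : 0 < orderOf l)
    (hl : ∀ a, (∃ t ∈ G, IsMatrixIn B t (scalarHom F a)) ↔ ∃ n : ℕ, a = l ^ n) :
    IsGorensteinRing ↥(invariantRing G) ↔ orderOf l ∣ orderOf α := by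
  have hdiag : diagonal ![1, (α : F), ((α⁻¹ : Fˣ) : F)] = diagHom F α := by
    rw [diagHom_apply]
    ext i j
    fin_cases i <;> fin_cases j <;> simp [blockMat]
  have hscal : diagonal ![(l : F)⁻¹ ^ 2, (l : F), (l : F)] = scalarHom F l := by
    rw [scalarHom_apply]
    ext i j
    fin_cases i <;> fin_cases j <;> simp [blockMat]
  have hgen : dihedralGenerators α l = {diagHom F α, swapMat F, scalarHom F l} := by
    rw [dihedralGenerators, hdiag, hscal]
  obtain ⟨B', hB'⟩ := h.isUnit.exists_right_inv
  refine isGorensteinRing_invariantRing_iff hB' α l hα0 (Units.odd_orderOf hl0) ?_ ?_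
  · rw [hgen]
    rintro M (rfl | rfl | rfl)
    · obtain ⟨t, ht, htα⟩ := (hα α).2 ⟨1, (pow_one α).symm⟩
      exact ⟨t, h.le ht, htα⟩
    · obtain ⟨t, ht, hts⟩ := h.exists_swap
      exact ⟨t, h.le ht, hts⟩
    · exact (hl l).2 ⟨1, (pow_one l).symm⟩
  · rw [hgen]
    intro g hg
    set S := Submonoid.closure {diagHom F α, swapMat F, scalarHom F l} with hS
    have hαS : ∀ n : ℕ, diagHom F (α ^ n) ∈ S := fun n => by
      rw [_root_.map_pow]
      exact S.pow_mem (Submonoid.subset_closure (by simp)) n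
    have hlS : ∀ n : ℕ, scalarHom F (l ^ n) ∈ S := fun n => by
      rw [_root_.map_pow]
      exact S.pow_mem (Submonoid.subset_closure (by simp)) n
    have hσS : swapMat F ∈ S := Submonoid.subset_closure (by simp)
    obtain ⟨c, k, hk, hkc, t, ht, rfl⟩ := h.exists_scalar_mul hα0 hα hg
    obtain ⟨n, rfl⟩ := (hl c).1 ⟨k, hk, hkc⟩
    obtain ⟨a, ha | ha⟩ := h.diag_or_anti t ht
    · obtain ⟨j, rfl⟩ := (hα a).1 ⟨t, ht, ha⟩
      exact ⟨_, S.mul_mem (hlS n) (hαS j), hkc.mul ha⟩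
    · obtain ⟨σ, hσ, hσm⟩ := h.exists_swap
      have h1 := ha.mul hσm
      rw [mul_assoc, swapMat_mul_swapMat, mul_one] at h1
      obtain ⟨j, rfl⟩ := (hα a).1 ⟨_, T.mul_mem ht hσ, h1⟩
      exact ⟨_, S.mul_mem (hlS n) (S.mul_mem (hαS j) hσS), hkc.mul ha⟩

end

/-! ### Restrictions to the plane -/

section
variable {F : Type u} [Field F] {G : Subgroup (Matrix.SpecialLinearGroup (Fin 3) F)}
  {w₁ w₂ : Fin 2 → F} {g : Matrix.SpecialLinearGroup (Fin 3) F}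

theorem exists_eq_smul_add_smul (hw : LinearIndependent F ![w₁, w₂]) (v : Fin 2 → F) :
    ∃ p q : F, v = p • w₁ + q • w₂ := by
  have h : Submodule.span F (Set.range ![w₁, w₂]) = ⊤ :=
    hw.span_eq_top_of_card_eq_finrank (by simp)
  rw [Matrix.range_cons_cons_empty] at h
  obtain ⟨p, q, hpq⟩ := Submodule.mem_span_pair.1 (h ▸ Submodule.mem_top : v ∈ _)
  exact ⟨p, q, hpq.symm⟩

theorem eq_of_vecMul_eq (hw : LinearIndependent F ![w₁, w₂]) {M N : Matrix (Fin 2) (Fin 2) F}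
    (h₁ : w₁ ᵥ* M = w₁ ᵥ* N) (h₂ : w₂ ᵥ* M = w₂ ᵥ* N) : M = N := by
  refine Matrix.ext_of_single_vecMul fun i => ?_
  obtain ⟨p, q, h⟩ := exists_eq_smul_add_smul hw (Pi.single i 1)
  rw [h]
  simp only [Matrix.add_vecMul, Matrix.smul_vecMul, h₁, h₂]

theorem LinearIndependent.pair_smul_right (hw : LinearIndependent F ![w₁, w₂]) {c : F}
    (hc : c ≠ 0) : LinearIndependent F ![w₁, c • w₂] := by
  rw [LinearIndependent.pair_iff] at hw ⊢
  intro s t h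
  rw [smul_smul] at h
  obtain ⟨h1, h2⟩ := hw s (t * c) h
  exact ⟨h1, (mul_eq_zero.1 h2).resolve_right hc⟩

theorem isMatrixIn_diagHom_iff (hg : IsBlock g) (h0 : (g : Matrix (Fin 3) (Fin 3) F) 0 0 = 1)
    (a : Fˣ) : IsMatrixIn (planeBasis w₁ w₂) g (diagHom F a) ↔
      w₁ ᵥ* subW g = (a : F) • w₁ ∧ w₂ ᵥ* subW g = (a : F)⁻¹ • w₂ := by
  rw [diagHom_apply, isMatrixIn_blockMat_iff hg]
  simp [h0]

theorem isMatrixIn_diagHom_mul_swapMat_iff (hg : IsBlock g)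
    (h0 : (g : Matrix (Fin 3) (Fin 3) F) 0 0 = 1) (a : Fˣ) :
    IsMatrixIn (planeBasis w₁ w₂) g (diagHom F a * swapMat F) ↔
      w₁ ᵥ* subW g = (a : F) • w₂ ∧ w₂ ᵥ* subW g = (a : F)⁻¹ • w₁ := by
  rw [diagHom_mul_swapMat, isMatrixIn_blockMat_iff hg]
  simp [h0]

theorem isMatrixIn_diagHom_of_vecMul (hw : LinearIndependent F ![w₁, w₂]) (hg : IsBlock g)
    (h0 : (g : Matrix (Fin 3) (Fin 3) F) 0 0 = 1) {b c : F} (h₁ : w₁ ᵥ* subW g = b • w₁)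
    (h₂ : w₂ ᵥ* subW g = c • w₂) :
    ∃ a : Fˣ, (a : F) = b ∧ IsMatrixIn (planeBasis w₁ w₂) g (diagHom F a) := by
  have hM : IsMatrixIn (planeBasis w₁ w₂) g (blockMat 1 b 0 0 c) := by
    rw [isMatrixIn_blockMat_iff hg]
    simp [h0, h₁, h₂]
  have hdet := hM.det_eq_one (isUnit_planeBasis hw)
  rw [det_blockMat] at hdet
  have hbc : b * c = 1 := by linear_combination hdet
  refine ⟨Units.mkOfMulEqOne b c hbc, rfl, (isMatrixIn_diagHom_iff hg h0 _).2 ⟨h₁, ?_⟩⟩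
  rw [h₂, Units.val_mkOfMulEqOne, eq_inv_of_mul_eq_one_right hbc]

theorem isMatrixIn_diagHom_mul_swapMat_of_vecMul [CharP F 2]
    (hw : LinearIndependent F ![w₁, w₂]) (hg : IsBlock g)
    (h0 : (g : Matrix (Fin 3) (Fin 3) F) 0 0 = 1) {b c : F} (h₁ : w₁ ᵥ* subW g = b • w₂)
    (h₂ : w₂ ᵥ* subW g = c • w₁) :
    ∃ a : Fˣ, (a : F) = b ∧ IsMatrixIn (planeBasis w₁ w₂) g (diagHom F a * swapMat F) := by
  have hM : IsMatrixIn (planeBasis w₁ w₂) g (blockMat 1 0 b c 0) := by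
    rw [isMatrixIn_blockMat_iff hg]
    simp [h0, h₁, h₂]
  have hdet := hM.det_eq_one (isUnit_planeBasis hw)
  rw [det_blockMat, mul_zero, zero_sub, one_mul, CharTwo.neg_eq] at hdet
  refine ⟨Units.mkOfMulEqOne b c hdet, rfl,
    (isMatrixIn_diagHom_mul_swapMat_iff hg h0 _).2 ⟨h₁, ?_⟩⟩
  rw [h₂, Units.val_mkOfMulEqOne, eq_inv_of_mul_eq_one_right hdet]

theorem isDihedralPair_of_vecMul [CharP F 2] (hblock : ∀ g ∈ G, IsBlock g)
    (hw : LinearIndependent F ![w₁, w₂])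
    (hperm : ∀ τ ∈ transSubgroup G, ∃ b c : F,
      (w₁ ᵥ* subW τ = b • w₁ ∧ w₂ ᵥ* subW τ = c • w₂) ∨
        (w₁ ᵥ* subW τ = b • w₂ ∧ w₂ ᵥ* subW τ = c • w₁))
    (hswap : ∃ τ ∈ transSubgroup G, w₁ ᵥ* subW τ = w₂)
    (hirr : ¬ ∀ τ ∈ transSubgroup G, (w₁ + w₂) ᵥ* subW τ = w₁ + w₂) :
    IsDihedralPair (planeBasis w₁ w₂) (transSubgroup G) G := by
  have hB := isUnit_planeBasis hw
  have hor : ∀ t ∈ transSubgroup G, ∃ a : Fˣ, IsMatrixIn (planeBasis w₁ w₂) t (diagHom F a) ∨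
      IsMatrixIn (planeBasis w₁ w₂) t (diagHom F a * swapMat F) := by
    intro t ht
    have hb := hblock t (transSubgroup_le G ht)
    have h0 := apply_zero_zero_of_mem_transSubgroup hblock ht
    obtain ⟨b, c, ⟨h1, h2⟩ | ⟨h1, h2⟩⟩ := hperm t ht
    · obtain ⟨a, -, ha⟩ := isMatrixIn_diagHom_of_vecMul hw hb h0 h1 h2
      exact ⟨a, Or.inl ha⟩
    · obtain ⟨a, -, ha⟩ := isMatrixIn_diagHom_mul_swapMat_of_vecMul hw hb h0 h1 h2
      exact ⟨a, Or.inr ha⟩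
  have hne := hw
  rw [LinearIndependent.pair_iff] at hne
  have hsw : ∃ t ∈ transSubgroup G, IsMatrixIn (planeBasis w₁ w₂) t (swapMat F) := by
    obtain ⟨t, ht, h⟩ := hswap
    have hb := hblock t (transSubgroup_le G ht)
    have h0 := apply_zero_zero_of_mem_transSubgroup hblock ht
    obtain ⟨b, c, ⟨h1, -⟩ | ⟨h1, h2⟩⟩ := hperm t ht
    · have := (hne b (-1) (by rw [← h1, h]; simp)).2
      simp at this
    · obtain ⟨a, -, ha⟩ := isMatrixIn_diagHom_mul_swapMat_of_vecMul hw hb h0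
        (h.trans (one_smul F w₂).symm) h2
      obtain rfl : a = 1 := by
        have h3 := ((isMatrixIn_diagHom_mul_swapMat_iff hb h0 a).1 ha).1
        have := (hne 0 (a - 1) (by rw [sub_smul, ← h3, h]; simp)).2
        exact Units.ext (sub_eq_zero.1 this)
      exact ⟨t, ht, by simpa using ha⟩
  refine ⟨hB, transSubgroup_le G, fun g hg t ht => conj_mem_transSubgroup hg ht, ?_, hor, hsw, ?_⟩
  · intro g hg
    obtain ⟨p, q, h1⟩ := exists_eq_smul_add_smul hw (w₁ ᵥ* subW g)
    obtain ⟨r, s, h2⟩ := exists_eq_smul_add_smul hw (w₂ ᵥ* subW g)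
    exact ⟨_, p, q, r, s, (isMatrixIn_blockMat_iff (hblock g hg) _ _ _ _ _).2 ⟨rfl, h1, h2⟩⟩
  · by_contra! hcon
    have h1 : ∀ a : Fˣ, ∀ t ∈ transSubgroup G,
        IsMatrixIn (planeBasis w₁ w₂) t (diagHom F a) → a = 1 :=
      fun a t ht h => by_contra fun ha => hcon a ha t ht h
    refine hirr fun t ht => ?_
    have hb := hblock t (transSubgroup_le G ht)
    have h0 := apply_zero_zero_of_mem_transSubgroup hblock ht
    obtain ⟨a, ha | ha⟩ := hor t ht
    · obtain rfl := h1 a t ht ha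
      obtain ⟨h2, h3⟩ := (isMatrixIn_diagHom_iff hb h0 _).1 ha
      rw [Matrix.add_vecMul, h2, h3]
      simp
    · obtain ⟨σ, hσ, hσm⟩ := hsw
      obtain rfl := h1 a _ ((transSubgroup G).mul_mem ht hσ) (by
        have := ha.mul hσm
        rwa [mul_assoc, swapMat_mul_swapMat, mul_one] at this)
      obtain ⟨h2, h3⟩ := (isMatrixIn_diagHom_mul_swapMat_iff hb h0 _).1 ha
      rw [Matrix.add_vecMul, h2, h3]
      simp [add_comm]

theorem exists_isDihedralPair [CharP F 2] (hblock : ∀ g ∈ G, IsBlock g)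
    (hw : LinearIndependent F ![w₁, w₂])
    (hperm : ∀ τ ∈ transSubgroup G,
      (w₁ ᵥ* subW τ ∈ Submodule.span F ({w₁} : Set (Fin 2 → F)) ∧
        w₂ ᵥ* subW τ ∈ Submodule.span F ({w₂} : Set (Fin 2 → F))) ∨
      (w₁ ᵥ* subW τ ∈ Submodule.span F ({w₂} : Set (Fin 2 → F)) ∧
        w₂ ᵥ* subW τ ∈ Submodule.span F ({w₁} : Set (Fin 2 → F))))
    (hirr : ∀ w : Fin 2 → F, w ≠ 0 →
      ¬ ∀ τ ∈ transSubgroup G, w ᵥ* subW τ ∈ Submodule.span F ({w} : Set (Fin 2 → F))) :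
    ∃ c : F, c ≠ 0 ∧ IsDihedralPair (planeBasis w₁ (c • w₂)) (transSubgroup G) G := by
  simp only [Submodule.mem_span_singleton] at hperm hirr
  have hw₁ : w₁ ≠ 0 := hw.ne_zero 0
  obtain ⟨τ, hτ, h1⟩ : ∃ τ ∈ transSubgroup G, ¬ ∃ a : F, a • w₁ = w₁ ᵥ* subW τ := by
    simpa using hirr w₁ hw₁
  obtain ⟨c, hc⟩ : ∃ c : F, c • w₂ = w₁ ᵥ* subW τ :=
    (hperm τ hτ).elim (fun h => absurd h.1 h1) fun h => h.1
  have hc0 : c ≠ 0 := by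
    rintro rfl
    exact h1 ⟨0, by rw [← hc]; simp⟩
  have hw' := hw.pair_smul_right hc0
  refine ⟨c, hc0, isDihedralPair_of_vecMul hblock hw' ?_ ⟨τ, hτ, hc.symm⟩ ?_⟩
  · intro t ht
    obtain ⟨⟨a, ha⟩, ⟨b, hb⟩⟩ | ⟨⟨a, ha⟩, ⟨b, hb⟩⟩ := hperm t ht
    · exact ⟨a, b, Or.inl ⟨ha.symm, by rw [Matrix.smul_vecMul, ← hb, smul_comm]⟩⟩
    · refine ⟨a * c⁻¹, c * b, Or.inr ⟨?_, by rw [Matrix.smul_vecMul, ← hb, smul_smul]⟩⟩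
      rw [smul_smul, mul_assoc, inv_mul_cancel₀ hc0, mul_one, ha]
  · intro h
    refine hirr (w₁ + c • w₂) ?_ fun t ht => ⟨1, by rw [h t ht, one_smul]⟩
    intro h0
    rw [LinearIndependent.pair_iff] at hw'
    simpa using (hw' 1 1 (by simpa using h0)).1

end

section
variable {F : Type u} [Field F] {G : Subgroup (Matrix.SpecialLinearGroup (Fin 3) F)}
  {w₁ w₂ : Fin 2 → F} {g : Matrix.SpecialLinearGroup (Fin 3) F}

theorem isMatrixIn_diagHom_smul_iff {c : F} (hc : c ≠ 0) (hg : IsBlock g)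
    (h0 : (g : Matrix (Fin 3) (Fin 3) F) 0 0 = 1) (a : Fˣ) :
    IsMatrixIn (planeBasis w₁ (c • w₂)) g (diagHom F a) ↔
      w₁ ᵥ* subW g = (a : F) • w₁ ∧ w₂ ᵥ* subW g = (a : F)⁻¹ • w₂ := by
  rw [isMatrixIn_diagHom_iff hg h0, Matrix.smul_vecMul, smul_comm _ c,
    (smul_right_injective _ hc).eq_iff]

theorem Units.exists_pow_of_pow_orderOf_eq_one {α : Fˣ} (hα : 0 < orderOf α) {ζ : F}
    (h : ζ ^ orderOf α = 1) : ∃ n : ℕ, ζ = (α ^ n : Fˣ) := by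
  have hprim : IsPrimitiveRoot (α : F) (orderOf α) :=
    IsPrimitiveRoot.coe_units_iff.2 (IsPrimitiveRoot.orderOf α)
  have : NeZero (orderOf α) := ⟨hα.ne'⟩
  obtain ⟨n, -, hn⟩ := hprim.eq_pow_of_pow_eq_one h
  exact ⟨n, by rw [Units.val_pow_eq_pow_val, hn]⟩

theorem Units.val_pow_pow_orderOf (α : Fˣ) (n : ℕ) : ((α ^ n : Fˣ) : F) ^ orderOf α = 1 := by
  rw [← Units.val_pow_eq_pow_val, ← pow_mul, mul_comm, pow_mul, pow_orderOf_eq_one, one_pow,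
    Units.val_one]

theorem subW_commutator_eq [CharP F 2] {c : F} (hc : c ≠ 0) (hblock : ∀ g ∈ G, IsBlock g)
    (hw : LinearIndependent F ![w₁, w₂])
    (h : IsDihedralPair (planeBasis w₁ (c • w₂)) (transSubgroup G) G) {α : Fˣ}
    (hα0 : 0 < orderOf α)
    (hα : ∀ a, (∃ t ∈ transSubgroup G, IsMatrixIn (planeBasis w₁ (c • w₂)) t (diagHom F a)) ↔
      ∃ n : ℕ, a = α ^ n) :
    {M : Matrix (Fin 2) (Fin 2) F | ∃ τ ∈ ⁅transSubgroup G, transSubgroup G⁆, subW τ = M} =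
      {M : Matrix (Fin 2) (Fin 2) F | ∃ ζ : F, ζ ^ orderOf α = 1 ∧
        w₁ ᵥ* M = ζ • w₁ ∧ w₂ ᵥ* M = ζ⁻¹ • w₂} := by
  have hle := Subgroup.commutator_le_self (transSubgroup G)
  ext M
  constructor
  · rintro ⟨τ, hτ, rfl⟩
    obtain ⟨a, ha⟩ := h.exists_diagHom_of_mem_commutator hτ
    obtain ⟨n, rfl⟩ := (hα a).1 ⟨τ, hle hτ, ha⟩
    exact ⟨_, Units.val_pow_pow_orderOf α n, (isMatrixIn_diagHom_smul_iff hc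
      (hblock τ (transSubgroup_le G (hle hτ)))
      (apply_zero_zero_of_mem_transSubgroup hblock (hle hτ)) _).1 ha⟩
  · rintro ⟨ζ, hζ, h1, h2⟩
    obtain ⟨n, rfl⟩ := Units.exists_pow_of_pow_orderOf_eq_one hα0 hζ
    obtain ⟨τ, hτ, hm⟩ := h.exists_mem_commutator hα0 ((hα α).2 ⟨1, (pow_one α).symm⟩) n
    obtain ⟨h3, h4⟩ := (isMatrixIn_diagHom_smul_iff hc
      (hblock τ (transSubgroup_le G (hle hτ)))
      (apply_zero_zero_of_mem_transSubgroup hblock (hle hτ)) _).1 hm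
    exact ⟨τ, hτ, eq_of_vecMul_eq hw (h3.trans h1.symm) (h4.trans h2.symm)⟩

theorem exists_vecMul_eq_smul (hw : LinearIndependent F ![w₁, w₂]) (a b : F) :
    ∃ M : Matrix (Fin 2) (Fin 2) F, w₁ ᵥ* M = a • w₁ ∧ w₂ ᵥ* M = b • w₂ := by
  have hu : IsUnit (Matrix.of ![w₁, w₂]) := by
    rw [← Matrix.linearIndependent_rows_iff_isUnit]
    exact hw
  obtain ⟨N, hN⟩ := hu.exists_right_inv
  have h : Matrix.of ![w₁, w₂] * (N * Matrix.of ![a • w₁, b • w₂]) =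
      Matrix.of ![a • w₁, b • w₂] := by rw [← mul_assoc, hN, one_mul]
  refine ⟨N * Matrix.of ![a • w₁, b • w₂], ?_, ?_⟩
  · have h0 := congrFun h 0
    rwa [Matrix.mul_apply_eq_vecMul] at h0
  · have h1 := congrFun h 1
    rwa [Matrix.mul_apply_eq_vecMul] at h1

theorem card_setOf_vecMul_eq_smul (hw : LinearIndependent F ![w₁, w₂]) {α : Fˣ}
    (hα0 : 0 < orderOf α) :
    Nat.card {M : Matrix (Fin 2) (Fin 2) F | ∃ ζ : F, ζ ^ orderOf α = 1 ∧
      w₁ ᵥ* M = ζ • w₁ ∧ w₂ ᵥ* M = ζ⁻¹ • w₂} = orderOf α := by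
  choose f hf₁ hf₂ using fun a : Fˣ => exists_vecMul_eq_smul hw (a : F) (a : F)⁻¹
  have hw₁ : w₁ ≠ 0 := hw.ne_zero 0
  rw [← Nat.card_zpowers]
  symm
  refine Nat.card_congr (Equiv.ofBijective (fun a : Subgroup.zpowers α =>
    ⟨f a, ((a : Fˣ) : F), ?_, hf₁ _, hf₂ _⟩) ⟨fun a b hab => ?_, ?_⟩)
  · rw [← Units.val_pow_eq_pow_val, ← Subgroup.coe_pow, pow_card_eq_one', Subgroup.coe_one,
      Units.val_one]
  · have h : f a = f b := congrArg Subtype.val hab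
    have h1 := hf₁ a
    rw [h, hf₁ b] at h1
    exact Subtype.ext (Units.ext (smul_left_injective F hw₁ h1).symm)
  · rintro ⟨M, ζ, hζ, h1, h2⟩
    rw [Nat.card_zpowers] at hζ
    obtain ⟨n, rfl⟩ := Units.exists_pow_of_pow_orderOf_eq_one hα0 hζ
    refine ⟨⟨α ^ n, n, by simp⟩, Subtype.ext ?_⟩
    exact eq_of_vecMul_eq hw ((hf₁ _).trans h1.symm) ((hf₂ _).trans h2.symm)

theorem IsDihedralPair.orderOf_dvd_iff [CharP F 2] {c : F} (hblock : ∀ g ∈ G, IsBlock g)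
    (hw : LinearIndependent F ![w₁, c • w₂])
    (h : IsDihedralPair (planeBasis w₁ (c • w₂)) (transSubgroup G) G) {α l : Fˣ}
    (hα0 : 0 < orderOf α)
    (hα : ∀ a, (∃ t ∈ transSubgroup G, IsMatrixIn (planeBasis w₁ (c • w₂)) t (diagHom F a)) ↔
      ∃ n : ℕ, a = α ^ n)
    (hl : ∀ a, (∃ t ∈ G, IsMatrixIn (planeBasis w₁ (c • w₂)) t (scalarHom F a)) ↔
      ∃ n : ℕ, a = l ^ n) :
    orderOf l ∣ orderOf α ↔ ∀ g ∈ G, ∃ τ ∈ transSubgroup G, ∃ ζ : F, ζ ^ orderOf α = 1 ∧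
      subW g = ζ • subW τ := by
  constructor
  · intro hdvd g hg
    obtain ⟨b, k, hk, hkb, t, ht, rfl⟩ :=
      h.exists_scalar_mul hα0 hα hg
    obtain ⟨n, rfl⟩ := (hl b).1 ⟨k, hk, hkb⟩
    refine ⟨t, ht, (l ^ n : Fˣ), ?_, ?_⟩
    · obtain ⟨m, hm⟩ := hdvd
      rw [hm, pow_mul, Units.val_pow_pow_orderOf, one_pow]
    · rw [scalarHom_apply, isMatrixIn_blockMat_iff (hblock k hk)] at hkb
      have hmul : subW (k * t) = subW k * subW t := by
        ext i j
        simp only [subW, Matrix.SpecialLinearGroup.coe_mul, Matrix.submatrix_apply,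
          Matrix.mul_apply, Fin.sum_univ_succ (n := 2)]
        have hk0 : (k : Matrix (Fin 3) (Fin 3) F) i.succ 0 = 0 := by
          obtain ⟨-, -, h1, h2⟩ := hblock k hk
          fin_cases i
          exacts [h1, h2]
        rw [hk0, zero_mul, zero_add]
      rw [hmul]
      refine eq_of_vecMul_eq hw ?_ ?_
      · rw [← Matrix.vecMul_vecMul, hkb.2.1, Matrix.vecMul_smul]
        simp [Matrix.smul_vecMul]
      · rw [← Matrix.vecMul_vecMul, hkb.2.2, Matrix.vecMul_smul]
        simp [Matrix.smul_vecMul]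
  · intro hall
    obtain ⟨k, hk, hkl⟩ := (hl l).2 ⟨1, (pow_one l).symm⟩
    rw [scalarHom_apply, isMatrixIn_blockMat_iff (hblock k hk)] at hkl
    obtain ⟨τ, hτ, ζ, hζ, hkτ⟩ := hall k hk
    have hb := hblock τ (transSubgroup_le G hτ)
    have h0 := apply_zero_zero_of_mem_transSubgroup hblock hτ
    have h1 : (l : F) • w₁ = ζ • w₁ ᵥ* subW τ := by
      rw [← Matrix.vecMul_smul, ← hkτ, hkl.2.1]
      simp
    have hli := LinearIndependent.pair_iff.1 hw
    obtain ⟨a, ha | ha⟩ := h.diag_or_anti τ hτ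
    · obtain ⟨n, rfl⟩ := (hα a).1 ⟨τ, hτ, ha⟩
      rw [((isMatrixIn_diagHom_iff hb h0 _).1 ha).1, smul_smul] at h1
      have h2 : (l : F) = ζ * (α ^ n : Fˣ) := smul_left_injective F (hw.ne_zero 0) h1
      refine orderOf_dvd_of_pow_eq_one (Units.ext ?_)
      rw [Units.val_pow_eq_pow_val, h2, mul_pow, hζ, Units.val_pow_pow_orderOf, one_mul,
        Units.val_one]
    · rw [((isMatrixIn_diagHom_mul_swapMat_iff hb h0 _).1 ha).1, smul_smul] at h1
      exact absurd (hli l (-(ζ * a)) (by rw [h1, neg_smul, add_neg_cancel])).1 l.ne_zero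

end

/-- Chapter A, case `char F = 2` and `T(G)|W` irreducible and imprimitive
(permuting the two lines `span {w₁}`, `span {w₂}`): the commutator subgroup of `T(G)|W` is
cyclic of order `d`, consisting of the matrices `diag(ζ, ζ⁻¹)` (with respect to `{w₁, w₂}`)
with `ζ^d = 1`, and `S(V)^G` is Gorenstein iff every `g|W` is a `d`-th root of unity
multiple of some `τ|W`, `τ ∈ T(G)`. -/
theorem stmt7 (F : Type u) [Field F] [CharP F 2]
    (G : Subgroup (Matrix.SpecialLinearGroup (Fin 3) F)) [Finite G]
    (hblock : ∀ g ∈ G, (g : Matrix (Fin 3) (Fin 3) F) 0 1 = 0 ∧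
      (g : Matrix (Fin 3) (Fin 3) F) 0 2 = 0 ∧ (g : Matrix (Fin 3) (Fin 3) F) 1 0 = 0 ∧
      (g : Matrix (Fin 3) (Fin 3) F) 2 0 = 0)
    (w₁ w₂ : Fin 2 → F) (hw : LinearIndependent F ![w₁, w₂])
    (hperm : ∀ τ ∈ transSubgroup G,
      (w₁ ᵥ* subW τ ∈ Submodule.span F ({w₁} : Set (Fin 2 → F)) ∧
        w₂ ᵥ* subW τ ∈ Submodule.span F ({w₂} : Set (Fin 2 → F))) ∨
      (w₁ ᵥ* subW τ ∈ Submodule.span F ({w₂} : Set (Fin 2 → F)) ∧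
        w₂ ᵥ* subW τ ∈ Submodule.span F ({w₁} : Set (Fin 2 → F))))
    (hirr : ∀ w : Fin 2 → F, w ≠ 0 →
      ¬ ∀ τ ∈ transSubgroup G, w ᵥ* subW τ ∈ Submodule.span F ({w} : Set (Fin 2 → F))) :
    ∃ d : ℕ, 0 < d ∧
      {M : Matrix (Fin 2) (Fin 2) F | ∃ τ ∈ ⁅transSubgroup G, transSubgroup G⁆, subW τ = M} =
        {M : Matrix (Fin 2) (Fin 2) F | ∃ ζ : F, ζ ^ d = 1 ∧
          w₁ ᵥ* M = ζ • w₁ ∧ w₂ ᵥ* M = ζ⁻¹ • w₂} ∧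
      Nat.card {M : Matrix (Fin 2) (Fin 2) F |
        ∃ τ ∈ ⁅transSubgroup G, transSubgroup G⁆, subW τ = M} = d ∧
      (IsGorensteinRing ↥(invariantRing G) ↔
        ∀ g ∈ G, ∃ τ ∈ transSubgroup G, ∃ ζ : F, ζ ^ d = 1 ∧ subW g = ζ • subW τ) := by
  have hfin : Finite ↥(transSubgroup G) :=
    Finite.of_injective _ (Subgroup.inclusion_injective (transSubgroup_le G))
  obtain ⟨c, hc, h⟩ := exists_isDihedralPair hblock hw hperm hirr
  obtain ⟨α, hα0, hα⟩ := exists_generator_unitsIn h.isUnit diagHom_injective (transSubgroup G)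
  obtain ⟨l, hl0, hl⟩ := exists_generator_unitsIn h.isUnit scalarHom_injective G
  have hset := subW_commutator_eq hc hblock hw h hα0 hα
  refine ⟨orderOf α, hα0, hset, ?_, ?_⟩
  · rw [hset]
    exact card_setOf_vecMul_eq_smul hw hα0
  · rw [h.isGorensteinRing_iff hα0 hα hl0 hl]
    exact h.orderOf_dvd_iff hblock (hw.pair_smul_right hc) hα0 hα hl

end
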